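/- arXiv:1404.3905 — 6 statements merged into one kernel-verified Lean document; each statement's English description precedes it below -/
import Mathlib

section
/- Let u ∈ ℋ_d and let r = (r_1,…,r_{d−1}) be a tuple of nonnegative integers. Then there exists a tensor v ∈ M_{≤r} (the output of the hierarchical singular value thresholding procedure) such that ‖u − v‖² ≤ Σ_{i=1}^{d−1} ε_i², where ε_i² = min{ ‖U^i − M‖_F² : M a matrix of the same size with rank(M) ≤ r_i } is the squared Frobenius distance of the i-th TT-matricisation U^i of u to the set of matrices of rank at most r_i. -/
/-- The `i`-th TT-matricisation of a tensor `u ∈ ℝ^{n_1 × ⋯ × n_d}` (zero-based: rows are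
indexed by the modes `j` with `j ≤ i`, columns by the remaining modes). -/
def ttMat {d : ℕ} (n : Fin d → ℕ) (u : ((j : Fin d) → Fin (n j)) → ℝ) (i : ℕ) :
    Matrix ((j : {j : Fin d // j.val ≤ i}) → Fin (n j.val))
           ((j : {j : Fin d // ¬ j.val ≤ i}) → Fin (n j.val)) ℝ :=
  fun ρ c => u fun j => if h : j.val ≤ i then ρ ⟨j, h⟩ else c ⟨j, h⟩

/-- `u` has TT-rank at most `r = (r_1, …, r_{d-1})`. -/
noncomputable def ttRankLE {d : ℕ} (n : Fin d → ℕ) (u : ((j : Fin d) → Fin (n j)) → ℝ)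
    (r : Fin (d - 1) → ℕ) : Prop :=
  ∀ i : Fin (d - 1), (ttMat n u i.val).rank ≤ r i

/-- The squared Frobenius norm of a real matrix. -/
def frobSq {m k : Type*} [Fintype m] [Fintype k] (X : Matrix m k ℝ) : ℝ :=
  ∑ p, ∑ q, X p q ^ 2

lemma frobSq_nonneg {m k : Type*} [Fintype m] [Fintype k] (X : Matrix m k ℝ) : 0 ≤ frobSq X := by
  unfold frobSq; positivity

lemma frobSq_eq_trace {m k : Type*} [Fintype m] [Fintype k] (X : Matrix m k ℝ) :
    frobSq X = (X.transpose * X).trace := by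
  simp only [frobSq, Matrix.trace, Matrix.diag, Matrix.mul_apply, Matrix.transpose_apply, pow_two]
  exact Finset.sum_comm

lemma frobSq_add_of_projection {m k : Type*} [Fintype m] [Fintype k] {A : Matrix m m ℝ}
    (hid : A * A = A) (hsymm : A.transpose = A) (X : Matrix m k ℝ) :
    frobSq X = frobSq (X - A * X) + frobSq (A * X) := by
  simp only [frobSq_eq_trace]
  rw [← Matrix.trace_add]
  congr 1
  have h : X.transpose * A * (A * X) = X.transpose * (A * X) := by
    rw [Matrix.mul_assoc, ← Matrix.mul_assoc A A X, hid]
  simp only [Matrix.transpose_sub, Matrix.transpose_mul, hsymm, Matrix.sub_mul, Matrix.mul_sub, h]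
  rw [Matrix.mul_assoc]
  abel

lemma frobSq_sub_mul_le {m k : Type*} [Fintype m] [Fintype k] {A : Matrix m m ℝ}
    (hid : A * A = A) (hsymm : A.transpose = A) (U W : Matrix m k ℝ) :
    frobSq (U - A * W) ≤ frobSq (U - A * U) + frobSq (U - W) := by
  have hX := frobSq_add_of_projection hid hsymm (U - A * W)
  have hAA : A * (A * W) = A * W := by rw [← Matrix.mul_assoc, hid]
  have h1 : U - A * W - A * (U - A * W) = U - A * U := by
    rw [Matrix.mul_sub, hAA]; abel
  have h2 : A * (U - A * W) = A * (U - W) := by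
    rw [Matrix.mul_sub, Matrix.mul_sub, hAA]
  rw [h1, h2] at hX
  have hY := frobSq_add_of_projection hid hsymm (U - W)
  linarith [frobSq_nonneg (U - W - A * (U - W))]

lemma frobSq_sub_projection_le {m k : Type*} [Fintype m] [Fintype k] {A : Matrix m m ℝ}
    (hid : A * A = A) (hsymm : A.transpose = A) (U : Matrix m k ℝ) {M : Matrix m k ℝ}
    (hM : A * M = M) : frobSq (U - A * U) ≤ frobSq (U - M) := by
  have hX := frobSq_add_of_projection hid hsymm (U - M)
  have h : U - M - A * (U - M) = U - A * U := by
    rw [Matrix.mul_sub, hM]; abel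
  rw [h] at hX
  linarith [frobSq_nonneg (A * (U - M))]

lemma trace_eq_rank_of_idempotent {m : Type*} [Fintype m] [DecidableEq m] {A : Matrix m m ℝ}
    (hid : A * A = A) : A.trace = A.rank := by
  have hA : IsIdempotentElem (Matrix.toLin' A) := by
    rw [IsIdempotentElem, Module.End.mul_eq_comp, ← Matrix.toLin'_mul, hid]
  rw [← Matrix.trace_toLin'_eq, Matrix.rank_eq_finrank_range_toLin A (Pi.basisFun ℝ m)
    (Pi.basisFun ℝ m)]
  exact (LinearMap.IsIdempotentElem.isProj_range _ hA).trace

/-- Witnessed by the orthogonal projection onto the column space of `M`. -/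
lemma exists_projection_fixing {m k : Type*} [Fintype m] [Fintype k] [DecidableEq m]
    [DecidableEq k] (M : Matrix m k ℝ) :
    ∃ A : Matrix m m ℝ, A * A = A ∧ A.transpose = A ∧ A.rank ≤ M.rank ∧ A * M = M := by
  set K := LinearMap.range (Matrix.toEuclideanLin M)
  obtain ⟨A, hA⟩ := (Matrix.toEuclideanLin (𝕜 := ℝ) (m := m) (n := m)).surjective
    K.starProjection.toLinearMap
  refine ⟨A, ?_, ?_, ?_, ?_⟩
  · apply Matrix.toEuclideanLin.injective
    rw [Matrix.toLpLin_mul_same, hA]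
    exact congrArg ContinuousLinearMap.toLinearMap K.isIdempotentElem_starProjection
  · have h : A.IsHermitian := by
      rw [← Matrix.isSymmetric_toEuclideanLin_iff, hA]
      exact K.starProjection_isSymmetric
    simpa [Matrix.IsHermitian] using h
  · rw [Matrix.rank_eq_finrank_range_toLin A (EuclideanSpace.basisFun m ℝ).toBasis
      (EuclideanSpace.basisFun m ℝ).toBasis,
      Matrix.rank_eq_finrank_range_toLin M (EuclideanSpace.basisFun m ℝ).toBasis
      (EuclideanSpace.basisFun k ℝ).toBasis,
      ← Matrix.toEuclideanLin_eq_toLin_orthonormal, ← Matrix.toEuclideanLin_eq_toLin_orthonormal,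
      hA]
    refine Submodule.finrank_mono ?_
    rintro _ ⟨x, rfl⟩
    exact K.starProjection_apply_mem x
  · apply Matrix.toEuclideanLin.injective
    rw [Matrix.toLpLin_mul_same, hA]
    ext1 x
    exact K.starProjection_eq_self_iff.2 ⟨x, rfl⟩

lemma isCompact_projections_trace_le (m : Type*) [Fintype m] (t : ℝ) :
    IsCompact {A : Matrix m m ℝ | A * A = A ∧ A.transpose = A ∧ A.trace ≤ t} := by
  have hK : IsCompact (Set.univ.pi fun _ : m => Set.univ.pi fun _ : m => Set.Icc (-1 : ℝ) 1) :=
    isCompact_univ_pi fun _ => isCompact_univ_pi fun _ => isCompact_Icc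
  refine hK.of_isClosed_subset (X := Matrix m m ℝ) ?_ ?_
  · refine IsClosed.inter (s₁ := {A : Matrix m m ℝ | A * A = A}) ?_
      (IsClosed.inter (s₁ := {A : Matrix m m ℝ | A.transpose = A}) ?_ ?_)
    · exact isClosed_eq (by fun_prop) (by fun_prop)
    · exact isClosed_eq (by fun_prop) (by fun_prop)
    · exact isClosed_le (continuous_id.matrix_trace) continuous_const
  · rintro A ⟨hid, hsymm, -⟩ p - q -
    have hdiag : ∑ j, A p j ^ 2 = A p p := by
      conv_rhs => rw [← hid, Matrix.mul_apply]
      refine Finset.sum_congr rfl fun j _ => ?_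
      rw [pow_two]; congr 1
      exact (congrFun (congrFun hsymm j) p)
    have hle (j : m) : A p j ^ 2 ≤ A p p := hdiag ▸
      Finset.single_le_sum (f := fun j => A p j ^ 2) (fun _ _ => sq_nonneg _) (Finset.mem_univ j)
    have h1 := hle p
    have h2 := hle q
    have h3 : A p p ≤ 1 := by nlinarith
    exact abs_le.1 (abs_le_one_iff_mul_self_le_one.2 (by linarith [pow_two (A p q)]))

lemma exists_best_projection {m k : Type*} [Fintype m] [Fintype k] [DecidableEq m]
    [DecidableEq k] (U : Matrix m k ℝ) (r : ℕ) :
    ∃ A : Matrix m m ℝ, A * A = A ∧ A.transpose = A ∧ A.rank ≤ r ∧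
      ∀ M : Matrix m k ℝ, M.rank ≤ r → frobSq (U - A * U) ≤ frobSq (U - M) := by
  have hcont : Continuous fun A : Matrix m m ℝ => frobSq (U - A * U) := by
    unfold frobSq
    refine continuous_finsetSum _ fun p _ => continuous_finsetSum _ fun q _ => ?_
    exact (Continuous.matrix_elem (by fun_prop) p q).pow 2
  obtain ⟨A, ⟨hid, hsymm, htr⟩, hmin⟩ :=
    (isCompact_projections_trace_le m (r : ℝ)).exists_isMinOn ⟨0, by simp⟩ hcont.continuousOn
  refine ⟨A, hid, hsymm, ?_, fun M hM => ?_⟩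
  · rw [trace_eq_rank_of_idempotent hid] at htr
    exact_mod_cast htr
  · obtain ⟨B, hBid, hBsymm, hBr, hBM⟩ := exists_projection_fixing M
    refine le_trans (hmin ⟨hBid, hBsymm, ?_⟩) (frobSq_sub_projection_le hBid hBsymm U hBM)
    rw [trace_eq_rank_of_idempotent hBid]
    exact_mod_cast hBr.trans hM

/-- The tensor whose `i`-th TT-matricisation is `X`. -/
def ttUnmat {d : ℕ} (n : Fin d → ℕ) (i : ℕ)
    (X : Matrix ((j : {j : Fin d // j.val ≤ i}) → Fin (n j.val))
      ((j : {j : Fin d // ¬ j.val ≤ i}) → Fin (n j.val)) ℝ) :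
    ((j : Fin d) → Fin (n j)) → ℝ :=
  fun μ => X (fun j => μ j.val) (fun j => μ j.val)

lemma ttMat_ttUnmat {d : ℕ} (n : Fin d → ℕ) (i : ℕ)
    (X : Matrix ((j : {j : Fin d // j.val ≤ i}) → Fin (n j.val))
      ((j : {j : Fin d // ¬ j.val ≤ i}) → Fin (n j.val)) ℝ) :
    ttMat n (ttUnmat n i X) i = X := by
  ext ρ c
  simp only [ttMat, ttUnmat]
  congr 1
  · funext j
    simp [j.2]
  · funext j
    simp [j.2]

lemma frobSq_ttMat {d : ℕ} (n : Fin d → ℕ) (w : ((j : Fin d) → Fin (n j)) → ℝ) (i : ℕ) :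
    frobSq (ttMat n w i) = ∑ μ, w μ ^ 2 := by
  rw [← (Equiv.piEquivPiSubtypeProd (fun j : Fin d => j.val ≤ i)
    (fun j => Fin (n j))).symm.sum_comp, Fintype.sum_prod_type]
  rfl

/-- Acting on the modes `≤ j` does not increase the rank of the `i`-th matricisation, `j ≤ i`. -/
lemma rank_ttMat_ttUnmat_mul_le {d : ℕ} (n : Fin d → ℕ) (w : ((j : Fin d) → Fin (n j)) → ℝ)
    {i j : ℕ} (hij : j ≤ i)
    (A : Matrix ((l : {l : Fin d // l.val ≤ j}) → Fin (n l.val))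
      ((l : {l : Fin d // l.val ≤ j}) → Fin (n l.val)) ℝ) :
    (ttMat n (ttUnmat n j (A * ttMat n w j)) i).rank ≤ (ttMat n w i).rank := by
  rw [Matrix.rank_eq_finrank_span_row, Matrix.rank_eq_finrank_span_row]
  refine Submodule.finrank_mono (Submodule.span_le.2 ?_)
  rintro _ ⟨ρ, rfl⟩
  have hrow : (ttMat n (ttUnmat n j (A * ttMat n w j)) i).row ρ =
      ∑ σ, A (fun l => ρ ⟨l.val, l.2.trans hij⟩) σ •
        (ttMat n w i).row (fun l => if h : l.val.val ≤ j then σ ⟨l.val, h⟩ else ρ l) := by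
    funext c
    simp only [Matrix.row, Finset.sum_apply, Pi.smul_apply, smul_eq_mul, ttMat, ttUnmat,
      Matrix.mul_apply]
    refine Finset.sum_congr rfl fun σ _ => ?_
    congr 1
    · congr 1
      funext l
      simp [l.2.trans hij]
    · congr 1
      funext l
      split_ifs <;> first | rfl | omega
  rw [hrow]
  exact Submodule.sum_mem _ fun σ _ => Submodule.smul_mem _ _ (Submodule.subset_span ⟨_, rfl⟩)

/-- hierarchical singular value thresholding error bound.  For every tensor
`u` and rank tuple `r` there is `v ∈ M_{≤ r}` with `‖u - v‖² ≤ ∑_{i=1}^{d-1} ε_i²`, where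
`ε_i²` is the squared Frobenius distance of the `i`-th TT-matricisation of `u` to the set
of matrices of rank at most `r_i`. -/
theorem hsvd_truncation_error {d : ℕ} (hd : 2 ≤ d) (n : Fin d → ℕ) (hn : ∀ i, 1 ≤ n i)
    (u : EuclideanSpace ℝ ((j : Fin d) → Fin (n j))) (r : Fin (d - 1) → ℕ) :
    ∃ v : EuclideanSpace ℝ ((j : Fin d) → Fin (n j)),
      ttRankLE n (fun μ => v μ) r ∧
      ‖u - v‖ ^ 2 ≤ ∑ i : Fin (d - 1),
        sInf {e : ℝ |
          ∃ M : Matrix ((j : {j : Fin d // j.val ≤ i.val}) → Fin (n j.val))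
                       ((j : {j : Fin d // ¬ j.val ≤ i.val}) → Fin (n j.val)) ℝ,
            M.rank ≤ r i ∧
            e = ∑ p, ∑ q, (ttMat n (fun μ => u μ) i.val p q - M p q) ^ 2} := by
  classical
  set ε : Fin (d - 1) → ℝ := fun i => sInf {e : ℝ |
          ∃ M : Matrix ((j : {j : Fin d // j.val ≤ i.val}) → Fin (n j.val))
                       ((j : {j : Fin d // ¬ j.val ≤ i.val}) → Fin (n j.val)) ℝ,
            M.rank ≤ r i ∧
            e = ∑ p, ∑ q, (ttMat n (fun μ => u μ) i.val p q - M p q) ^ 2}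
  have key (s : Finset (Fin (d - 1))) : ∃ v : ((j : Fin d) → Fin (n j)) → ℝ,
      (∀ i ∈ s, (ttMat n v i.val).rank ≤ r i) ∧ ∑ μ, (u μ - v μ) ^ 2 ≤ ∑ i ∈ s, ε i := by
    induction s using Finset.induction_on_min with
    | empty => exact ⟨fun μ => u μ, by simp, by simp⟩
    | insert a s has ih =>
      obtain ⟨w, hrank, herr⟩ := ih
      obtain ⟨A, hid, hsymm, hA, hbest⟩ := exists_best_projection (ttMat n (fun μ => u μ) a) (r a)
      refine ⟨ttUnmat n a (A * ttMat n w a), fun i hi => ?_, ?_⟩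
      · rcases Finset.mem_insert.1 hi with rfl | hi
        · rw [ttMat_ttUnmat]
          exact (Matrix.rank_mul_le_left _ _).trans hA
        · exact (rank_ttMat_ttUnmat_mul_le n w (has i hi).le A).trans (hrank i hi)
      · rw [Finset.sum_insert fun h => lt_irrefl _ (has a h)]
        have hle := frobSq_sub_mul_le hid hsymm (ttMat n (fun μ => u μ) a) (ttMat n w a)
        have hε : frobSq (ttMat n (fun μ => u μ) a - A * ttMat n (fun μ => u μ) a) ≤ ε a := by
          refine le_csInf ⟨_, 0, by simp, rfl⟩ ?_
          rintro _ ⟨M, hM, rfl⟩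
          exact hbest M hM
        have hw : frobSq (ttMat n (fun μ => u μ) a - ttMat n w a) = ∑ μ, (u μ - w μ) ^ 2 :=
          frobSq_ttMat n (fun μ => u μ - w μ) a
        have hv : frobSq (ttMat n (fun μ => u μ) a - A * ttMat n w a) =
            ∑ μ, (u μ - ttUnmat n a (A * ttMat n w a) μ) ^ 2 := by
          conv_lhs => rw [← ttMat_ttUnmat n a (A * ttMat n w a)]
          exact frobSq_ttMat n (fun μ => u μ - ttUnmat n a (A * ttMat n w a) μ) a
        linarith
  obtain ⟨v, hrank, herr⟩ := key Finset.univ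
  refine ⟨WithLp.toLp 2 v, fun i => hrank i (Finset.mem_univ i), ?_⟩
  rw [EuclideanSpace.real_norm_sq_eq]
  exact herr
end

section
/- Let u ∈ ℋ_d and let (r_1,…,r_d) be a tuple of nonnegative integers. Then there exists a tensor v ∈ ℋ_d of Tucker rank at most (r_1,…,r_d) (the output of the truncated higher order singular value decomposition) such that ‖u − v‖² ≤ Σ_{i=1}^{d} ε_i², where ε_i² = min{ ‖U^{(i)} − M‖_F² : M a matrix of the same size with rank(M) ≤ r_i } is the squared Frobenius distance of the mode-i matricisation U^{(i)} of u to the set of matrices of rank at most r_i. -/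
/-- The mode-`i` matricisation of a tensor `u ∈ ℝ^{n_1 × ⋯ × n_d}`: rows indexed by the
`i`-th mode, columns by all remaining modes. -/
def modeMat {d : ℕ} (n : Fin d → ℕ) (u : ((j : Fin d) → Fin (n j)) → ℝ) (i : Fin d) :
    Matrix (Fin (n i)) ((j : {j : Fin d // j ≠ i}) → Fin (n j.val)) ℝ :=
  fun μi c => u fun j => if h : j = i then Fin.cast (congrArg n h.symm) μi else c ⟨j, h⟩

/-- `u` has Tucker rank at most `(r_1, …, r_d)`:  every mode-`i` matricisation has rank at
most `r_i`. -/
noncomputable def tuckerRankLE {d : ℕ} (n : Fin d → ℕ) (u : ((j : Fin d) → Fin (n j)) → ℝ)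
    (r : Fin d → ℕ) : Prop :=
  ∀ i : Fin d, (modeMat n u i).rank ≤ r i

namespace Matrix

variable {m k : Type*} [Fintype m] [Fintype k]

theorem sum_sq_eq_trace (A : Matrix m k ℝ) : ∑ p, ∑ q, A p q ^ 2 = (Aᵀ * A).trace := by
  simp only [trace, diag, mul_apply, transpose_apply, ← pow_two]
  exact Finset.sum_comm

theorem sum_sq_add_of_transpose_mul_eq_zero {A B : Matrix m k ℝ} (h : Aᵀ * B = 0) :
    ∑ p, ∑ q, (A + B) p q ^ 2 = ∑ p, ∑ q, A p q ^ 2 + ∑ p, ∑ q, B p q ^ 2 := by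
  have h' : Bᵀ * A = 0 := by simpa using congrArg transpose h
  simp only [sum_sq_eq_trace, transpose_add, Matrix.add_mul, Matrix.mul_add, h, h', add_zero,
    zero_add, trace_add]

/-- Orthogonal projections of rank at most `r`; the rank is expressed through the trace. -/
def orthProjSet (m : Type*) [Fintype m] (r : ℕ) : Set (Matrix m m ℝ) :=
  {P | Pᵀ = P ∧ P * P = P ∧ P.trace ≤ r}

theorem isCompact_orthProjSet (r : ℕ) : IsCompact (orthProjSet m r) := by
  have hsub : orthProjSet m r ⊆
      Set.univ.pi fun _ => Set.univ.pi fun _ => Set.Icc (-1 : ℝ) 1 := by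
    rintro P ⟨hT, hI, -⟩ i - j -
    have key : ∑ l, P i l ^ 2 = P i i := by
      conv_rhs => rw [← hI, mul_apply]
      refine Finset.sum_congr rfl fun l _ => ?_
      rw [pow_two, ← congrFun (congrFun hT l) i, transpose_apply]
    have hle : ∀ l, P i l ^ 2 ≤ P i i := fun l =>
      key ▸ Finset.single_le_sum (f := fun l => P i l ^ 2) (fun _ _ => sq_nonneg _)
        (Finset.mem_univ l)
    have h1 : P i i ≤ 1 := by nlinarith [hle i]
    exact abs_le.1 ((sq_le_one_iff_abs_le_one _).1 ((hle j).trans h1))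
  refine IsCompact.of_isClosed_subset
    (isCompact_univ_pi fun _ => isCompact_univ_pi fun _ => isCompact_Icc) ?_ hsub
  have h1 : IsClosed {P : Matrix m m ℝ | Pᵀ = P} := isClosed_eq (by fun_prop) (by fun_prop)
  have h2 : IsClosed {P : Matrix m m ℝ | P * P = P} := isClosed_eq (by fun_prop) (by fun_prop)
  have h3 : IsClosed {P : Matrix m m ℝ | P.trace ≤ r} := isClosed_le (by fun_prop) (by fun_prop)
  exact h1.inter (h2.inter h3)

theorem sum_sq_sub_proj_mul_le {P : Matrix m m ℝ} (hT : Pᵀ = P) (hI : P * P = P)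
    (U M : Matrix m k ℝ) (hM : P * M = M) :
    ∑ p, ∑ q, (U p q - (P * U) p q) ^ 2 ≤ ∑ p, ∑ q, (U p q - M p q) ^ 2 := by
  have h : (U - P * U)ᵀ * (P * (U - M)) = 0 := by
    rw [transpose_sub, transpose_mul, hT, ← Matrix.mul_assoc, Matrix.sub_mul, Matrix.mul_assoc Uᵀ,
      hI, sub_self, Matrix.zero_mul]
  have h2 := sum_sq_add_of_transpose_mul_eq_zero h
  rw [Matrix.mul_sub, hM, sub_add_sub_cancel] at h2
  simp only [sub_apply] at h2
  rw [h2]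
  exact le_add_of_nonneg_right
    (Finset.sum_nonneg fun _ _ => Finset.sum_nonneg fun _ _ => sq_nonneg _)

variable [DecidableEq m]

theorem rank_eq_trace_of_mul_self {P : Matrix m m ℝ} (hP : P * P = P) :
    (P.rank : ℝ) = P.trace := by
  have h : IsIdempotentElem (toLin' P) := by
    rw [IsIdempotentElem, Module.End.mul_eq_comp, ← toLin'_mul, hP]
  rw [← trace_toLin'_eq, (LinearMap.IsIdempotentElem.isProj_range _ h).trace, rank, toLin'_apply']

theorem exists_orthProj_mul_eq_self [DecidableEq k] (M : Matrix m k ℝ) {r : ℕ}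
    (hM : M.rank ≤ r) : ∃ P ∈ orthProjSet m r, P * M = M := by
  set K := LinearMap.range (toEuclideanLin M) with hK
  set P : Matrix m m ℝ := (toEuclideanCLM (𝕜 := ℝ)).symm K.starProjection with hPdef
  have hPK : toEuclideanCLM (𝕜 := ℝ) P = K.starProjection := by simp [hPdef]
  have hstar := isStarProjection_starProjection (U := K)
  have hI : P * P = P := by
    apply EquivLike.injective (toEuclideanCLM (n := m) (𝕜 := ℝ))
    rw [map_mul, hPK]
    exact hstar.isIdempotentElem
  have hT : Pᵀ = P := by
    rw [← conjTranspose_eq_transpose_of_trivial, ← star_eq_conjTranspose]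
    apply EquivLike.injective (toEuclideanCLM (n := m) (𝕜 := ℝ))
    rw [map_star, hPK]
    exact hstar.isSelfAdjoint
  have hrank : P.rank = M.rank := by
    rw [rank_eq_finrank_range_toLin P (EuclideanSpace.basisFun m ℝ).toBasis
        (EuclideanSpace.basisFun m ℝ).toBasis, rank_eq_finrank_range_toLin M
        (EuclideanSpace.basisFun m ℝ).toBasis (EuclideanSpace.basisFun k ℝ).toBasis,
      ← toEuclideanLin_eq_toLin_orthonormal, ← toEuclideanLin_eq_toLin_orthonormal,
      ← coe_toEuclideanCLM_eq_toEuclideanLin, hPK, ← hK]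
    exact congrArg (fun S : Submodule ℝ (EuclideanSpace ℝ m) => Module.finrank ℝ S)
      (Submodule.range_starProjection K)
  refine ⟨P, ⟨hT, hI, ?_⟩, ?_⟩
  · rw [← rank_eq_trace_of_mul_self hI, hrank]
    exact_mod_cast hM
  · apply (toEuclideanLin (𝕜 := ℝ) (m := m) (n := k)).injective
    ext1 x
    rw [toEuclideanLin, toLpLin_mul_same, LinearMap.comp_apply,
      ← toEuclideanLin, ← coe_toEuclideanCLM_eq_toEuclideanLin, hPK]
    exact Submodule.starProjection_eq_self_iff.2 ⟨x, rfl⟩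

/-- The distance of `U` to the matrices of rank at most `r` is realised by an orthogonal projection
of the columns of `U`. -/
theorem exists_orthProj_sum_sq_le [DecidableEq k] (U : Matrix m k ℝ) (r : ℕ) :
    ∃ P : Matrix m m ℝ, Pᵀ = P ∧ P * P = P ∧ P.rank ≤ r ∧
      ∀ M : Matrix m k ℝ, M.rank ≤ r →
        ∑ p, ∑ q, (U p q - (P * U) p q) ^ 2 ≤ ∑ p, ∑ q, (U p q - M p q) ^ 2 := by
  have hcont : Continuous fun P : Matrix m m ℝ => ∑ p, ∑ q, (U p q - (P * U) p q) ^ 2 := by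
    simp only [mul_apply]
    fun_prop
  obtain ⟨P, ⟨hT, hI, htr⟩, hmin⟩ := (isCompact_orthProjSet (m := m) r).exists_isMinOn
    ⟨0, by simp [orthProjSet]⟩ hcont.continuousOn
  refine ⟨P, hT, hI, ?_, fun M hM => ?_⟩
  · rw [← rank_eq_trace_of_mul_self hI] at htr
    exact_mod_cast htr
  · obtain ⟨Q, hQ, hQM⟩ := exists_orthProj_mul_eq_self M hM
    exact (isMinOn_iff.1 hmin Q hQ).trans (sum_sq_sub_proj_mul_le hQ.1 hQ.2.1 U M hQM)

end Matrix

theorem LinearMap.IsSymmetric.norm_sub_apply_sq_le {E : Type*} [NormedAddCommGroup E]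
    [InnerProductSpace ℝ E] {T : E →ₗ[ℝ] E} (hs : T.IsSymmetric) (hT : ∀ x, T (T x) = T x)
    (u w : E) : ‖u - T w‖ ^ 2 ≤ ‖u - T u‖ ^ 2 + ‖u - w‖ ^ 2 := by
  have orth : ∀ x y, inner ℝ (x - T x) (T y) = 0 := fun x y => by
    rw [← hs, map_sub, hT, sub_self, inner_zero_left]
  have pyth : ∀ x y, ‖x - T x + T y‖ ^ 2 = ‖x - T x‖ ^ 2 + ‖T y‖ ^ 2 := fun x y => by
    rw [norm_add_sq_real, orth, mul_zero, add_zero]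
  have h1 := pyth u (u - w)
  have h2 := pyth (u - w) (u - w)
  rw [map_sub, sub_add_sub_cancel] at h1
  rw [sub_add_cancel, map_sub] at h2
  nlinarith [sq_nonneg ‖u - w - (T u - T w)‖]

/-- The product of commuting orthogonal projections, applied to `u`. -/
theorem exists_mem_range_norm_sub_sq_le_sum {ι E : Type*} [NormedAddCommGroup E]
    [InnerProductSpace ℝ E] (T : ι → E →ₗ[ℝ] E) (hs : ∀ i, (T i).IsSymmetric)
    (hT : ∀ i x, T i (T i x) = T i x) (hc : ∀ i j, i ≠ j → ∀ x, T i (T j x) = T j (T i x))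
    (u : E) (s : Finset ι) :
    ∃ v, (∀ i ∈ s, ∃ w, v = T i w) ∧ ‖u - v‖ ^ 2 ≤ ∑ i ∈ s, ‖u - T i u‖ ^ 2 := by
  classical
  induction s using Finset.induction_on with
  | empty => exact ⟨u, by simp⟩
  | insert j s hj ih =>
    obtain ⟨v, hv, hle⟩ := ih
    refine ⟨T j v, fun i hi => ?_, ?_⟩
    · rcases Finset.mem_insert.1 hi with rfl | hi
      · exact ⟨v, rfl⟩
      · obtain ⟨w, rfl⟩ := hv i hi
        exact ⟨T j w, hc j i (fun h => hj (h ▸ hi)) w⟩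
    · rw [Finset.sum_insert hj]
      exact ((hs j).norm_sub_apply_sq_le (hT j) u v).trans (by gcongr)

section ModeProduct

variable {d : ℕ} (n : Fin d → ℕ)

theorem modeMat_eq_piSplitAt_symm (u : ((j : Fin d) → Fin (n j)) → ℝ) (i : Fin d)
    (p : Fin (n i)) (q : (j : {j : Fin d // j ≠ i}) → Fin (n j.val)) :
    modeMat n u i p q = u ((Equiv.piSplitAt i fun j => Fin (n j)).symm (p, q)) := by
  refine congrArg u (funext fun j => ?_)
  by_cases h : j = i
  · subst h
    simp [Equiv.piSplitAt]
  · simp [Equiv.piSplitAt, h]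

theorem update_piSplitAt_symm (i : Fin d) (p a : Fin (n i))
    (q : (j : {j : Fin d // j ≠ i}) → Fin (n j.val)) :
    Function.update ((Equiv.piSplitAt i fun j => Fin (n j)).symm (p, q)) i a =
      (Equiv.piSplitAt i fun j => Fin (n j)).symm (a, q) := by
  funext j
  by_cases h : j = i
  · subst h
    simp [Equiv.piSplitAt]
  · simp [Equiv.piSplitAt, h]

theorem modeMat_injective (i : Fin d) : Function.Injective fun u => modeMat n u i := by
  intro u v h
  funext μ
  have := congrFun (congrFun h (μ i)) fun j => μ j
  simp only [modeMat_eq_piSplitAt_symm] at this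
  have hμ : (Equiv.piSplitAt i fun j => Fin (n j)).symm (μ i, fun j => μ j) = μ :=
    (Equiv.piSplitAt i fun j => Fin (n j)).symm_apply_apply μ
  rwa [hμ] at this

theorem sum_eq_sum_modeMat (i : Fin d) (f : ((j : Fin d) → Fin (n j)) → ℝ) :
    ∑ μ, f μ = ∑ p, ∑ q, modeMat n f i p q := by
  simp only [modeMat_eq_piSplitAt_symm]
  rw [← Fintype.sum_prod_type',
    Equiv.sum_comp (Equiv.piSplitAt i fun j => Fin (n j)).symm]

/-- Multiplication of a tensor by a matrix `P` in mode `i`. -/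
noncomputable def modeMul (i : Fin d) (P : Matrix (Fin (n i)) (Fin (n i)) ℝ) :
    EuclideanSpace ℝ ((j : Fin d) → Fin (n j)) →ₗ[ℝ]
      EuclideanSpace ℝ ((j : Fin d) → Fin (n j)) where
  toFun u := WithLp.toLp 2 fun μ => ∑ a, P (μ i) a * u (Function.update μ i a)
  map_add' u v := by
    ext μ
    simp [mul_add, Finset.sum_add_distrib]
  map_smul' c u := by
    ext μ
    simp only [PiLp.smul_apply, smul_eq_mul, RingHom.id_apply, Finset.mul_sum]
    exact Finset.sum_congr rfl fun _ _ => by ring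

theorem modeMul_apply (i : Fin d) (P : Matrix (Fin (n i)) (Fin (n i)) ℝ)
    (u : EuclideanSpace ℝ ((j : Fin d) → Fin (n j))) (μ : (j : Fin d) → Fin (n j)) :
    modeMul n i P u μ = ∑ a, P (μ i) a * u (Function.update μ i a) := rfl

theorem modeMat_modeMul (i : Fin d) (P : Matrix (Fin (n i)) (Fin (n i)) ℝ)
    (u : EuclideanSpace ℝ ((j : Fin d) → Fin (n j))) :
    modeMat n (fun μ => modeMul n i P u μ) i = P * modeMat n (fun μ => u μ) i := by
  ext p q
  simp only [modeMat_eq_piSplitAt_symm, modeMul_apply, Matrix.mul_apply, update_piSplitAt_symm]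
  refine Finset.sum_congr rfl fun a _ => ?_
  congr 2
  simp [Equiv.piSplitAt]

theorem modeMul_modeMul_self (i : Fin d) {P : Matrix (Fin (n i)) (Fin (n i)) ℝ} (hI : P * P = P)
    (u : EuclideanSpace ℝ ((j : Fin d) → Fin (n j))) :
    modeMul n i P (modeMul n i P u) = modeMul n i P u := by
  apply WithLp.ofLp_injective
  apply modeMat_injective n i
  simp only [modeMat_modeMul, ← Matrix.mul_assoc, hI]

theorem modeMul_comm {i j : Fin d} (hij : i ≠ j) (P : Matrix (Fin (n i)) (Fin (n i)) ℝ)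
    (Q : Matrix (Fin (n j)) (Fin (n j)) ℝ) (u : EuclideanSpace ℝ ((j : Fin d) → Fin (n j))) :
    modeMul n i P (modeMul n j Q u) = modeMul n j Q (modeMul n i P u) := by
  ext μ
  simp only [modeMul_apply, Finset.mul_sum, Function.update_of_ne hij,
    Function.update_of_ne hij.symm]
  rw [Finset.sum_comm]
  refine Finset.sum_congr rfl fun b _ => Finset.sum_congr rfl fun a _ => ?_
  rw [Function.update_comm hij]
  ring

theorem inner_eq_trace_modeMat (i : Fin d) (u v : EuclideanSpace ℝ ((j : Fin d) → Fin (n j))) :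
    inner ℝ u v = ((modeMat n (fun μ => u μ) i).transpose * modeMat n (fun μ => v μ) i).trace := by
  rw [PiLp.inner_apply, sum_eq_sum_modeMat n i]
  refine Finset.sum_comm.trans ?_
  simp [Matrix.trace, Matrix.mul_apply, modeMat, mul_comm]

theorem modeMul_isSymmetric (i : Fin d) {P : Matrix (Fin (n i)) (Fin (n i)) ℝ} (hT : P.transpose = P) :
    (modeMul n i P).IsSymmetric := by
  intro u v
  rw [inner_eq_trace_modeMat n i, inner_eq_trace_modeMat n i, modeMat_modeMul, modeMat_modeMul,
    Matrix.transpose_mul, hT, Matrix.mul_assoc]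

theorem norm_sub_modeMul_sq (i : Fin d) (P : Matrix (Fin (n i)) (Fin (n i)) ℝ)
    (u : EuclideanSpace ℝ ((j : Fin d) → Fin (n j))) :
    ‖u - modeMul n i P u‖ ^ 2 = ∑ p, ∑ q,
      (modeMat n (fun μ => u μ) i p q - (P * modeMat n (fun μ => u μ) i) p q) ^ 2 := by
  rw [EuclideanSpace.real_norm_sq_eq, sum_eq_sum_modeMat n i, ← modeMat_modeMul]
  rfl

end ModeProduct

/-- truncated HOSVD error bound.  For every tensor `u` and rank tuple
`(r_1, …, r_d)` there is a tensor `v` of Tucker rank at most `(r_1, …, r_d)` with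
`‖u - v‖² ≤ ∑_{i=1}^d ε_i²`, where `ε_i²` is the squared Frobenius distance of the mode-`i`
matricisation of `u` to the set of matrices of rank at most `r_i`. -/
theorem hosvd_truncation_error {d : ℕ} (hd : 2 ≤ d) (n : Fin d → ℕ) (hn : ∀ i, 1 ≤ n i)
    (u : EuclideanSpace ℝ ((j : Fin d) → Fin (n j))) (r : Fin d → ℕ) :
    ∃ v : EuclideanSpace ℝ ((j : Fin d) → Fin (n j)),
      tuckerRankLE n (fun μ => v μ) r ∧
      ‖u - v‖ ^ 2 ≤ ∑ i : Fin d,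
        sInf {e : ℝ |
          ∃ M : Matrix (Fin (n i)) ((j : {j : Fin d // j ≠ i}) → Fin (n j.val)) ℝ,
            M.rank ≤ r i ∧
            e = ∑ p, ∑ q, (modeMat n (fun μ => u μ) i p q - M p q) ^ 2} := by
  choose P hT hI hr hmin using fun i => (modeMat n (fun μ => u μ) i).exists_orthProj_sum_sq_le (r i)
  obtain ⟨v, hv, hle⟩ := exists_mem_range_norm_sub_sq_le_sum (fun i => modeMul n i (P i))
    (fun i => modeMul_isSymmetric n i (hT i)) (fun i => modeMul_modeMul_self n i (hI i))
    (fun i j hij => modeMul_comm n hij (P i) (P j)) u Finset.univ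
  refine ⟨v, fun i => ?_, hle.trans (Finset.sum_le_sum fun i _ => ?_)⟩
  · obtain ⟨w, rfl⟩ := hv i (Finset.mem_univ i)
    rw [modeMat_modeMul]
    exact (Matrix.rank_mul_le_left _ _).trans (hr i)
  · rw [norm_sub_modeMul_sq]
    refine le_csInf ⟨_, 0, by simp, rfl⟩ ?_
    rintro _ ⟨M, hM, rfl⟩
    exact hmin i M hM
end

section
/- (Conditionally global convergence of tensor iterative hard thresholding.) Let 𝒜 : ℋ_d → ℝ^m be linear with adjoint 𝒜*, let r = (r_1,…,r_{d−1}), and suppose 𝒜 satisfies the tensor restricted isometry property of order 3r with constant δ < 1/2. Let u ∈ M_{≤r} and b = 𝒜u. Let (u^n)_{n≥0} be a sequence in M_{≤r} such that, setting y^{n+1} = u^n + 𝒜*(b − 𝒜u^n), each iterate satisfies u^{n+1} ∈ M_{≤r} and the thresholding condition ‖u^{n+1} − y^{n+1}‖ ≤ ‖u − y^{n+1}‖. Then with ρ := √(δ/(1−δ)) < 1 one has ‖u^{n+1} − u‖ ≤ ρ‖u^n − u‖ for all n; consequently ‖u^n − u‖ ≤ ρ^n‖u^0 − u‖ and u^n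 converges to u. -/
/-- The tensor space `ℋ_d = ℝ^{n_1 × ⋯ × n_d}` with the Euclidean inner product. -/
abbrev TensorSpace (d : ℕ) (n : Fin d → ℕ) := EuclideanSpace ℝ ((j : Fin d) → Fin (n j))

/-- Scaling a matrix does not increase its rank. -/
theorem Matrix.rank_smul_le_rank {ι κ : Type*} [Fintype ι] [Fintype κ] [DecidableEq ι]
    (a : ℝ) (M : Matrix ι κ ℝ) : (a • M).rank ≤ M.rank := by
  have h : a • M = (a • (1 : Matrix ι ι ℝ)) * M := by simp
  rw [h]
  exact Matrix.rank_mul_le_right _ _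

/-- The rank of matrices is subadditive. -/
theorem Matrix.rank_add_le_rank_add_rank {ι κ : Type*} [Finite ι] [Fintype κ]
    (M N : Matrix ι κ ℝ) : (M + N).rank ≤ M.rank + N.rank := by
  unfold Matrix.rank
  rw [Matrix.mulVecLin_add]
  exact (Submodule.finrank_mono (LinearMap.range_add_le _ _)).trans
    (Submodule.finrank_add_le_finrank_add_finrank _ _)

/-- A linear combination of three tensors of TT-rank at most `r` has TT-rank at most `3r`. -/
theorem ttRankLE.linearCombination {d : ℕ} {n : Fin d → ℕ} {x y z : TensorSpace d n}
    {r : Fin (d - 1) → ℕ} (hx : ttRankLE n (fun μ => x μ) r) (hy : ttRankLE n (fun μ => y μ) r)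
    (hz : ttRankLE n (fun μ => z μ) r) (a b c : ℝ) :
    ttRankLE n (fun μ => (a • x + b • y + c • z) μ) (fun i => 3 * r i) := by
  classical
  intro i
  have h : ttMat n (fun μ => (a • x + b • y + c • z) μ) i.val =
      a • ttMat n (fun μ => x μ) i.val + b • ttMat n (fun μ => y μ) i.val +
        c • ttMat n (fun μ => z μ) i.val := by
    ext ρ σ
    simp [ttMat]
  rw [h]
  have h₁ := Matrix.rank_add_le_rank_add_rank
    (a • ttMat n (fun μ => x μ) i.val + b • ttMat n (fun μ => y μ) i.val)
    (c • ttMat n (fun μ => z μ) i.val)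
  have h₂ := Matrix.rank_add_le_rank_add_rank
    (a • ttMat n (fun μ => x μ) i.val) (b • ttMat n (fun μ => y μ) i.val)
  have hx' := (Matrix.rank_smul_le_rank a (ttMat n (fun μ => x μ) i.val)).trans (hx i)
  have hy' := (Matrix.rank_smul_le_rank b (ttMat n (fun μ => y μ) i.val)).trans (hy i)
  have hz' := (Matrix.rank_smul_le_rank c (ttMat n (fun μ => z μ) i.val)).trans (hz i)
  dsimp only
  omega

section RestrictedIsometry

variable {E F : Type*} [NormedAddCommGroup E] [InnerProductSpace ℝ E]
  [NormedAddCommGroup F] [InnerProductSpace ℝ F]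

/-- A map that is nearly isometric on the span of `f` and `e` nearly preserves their inner
product. -/
theorem inner_sub_inner_map_le (A : E →ₗ[ℝ] F) {δ : ℝ} {e f : E}
    (h : ∀ s t : ℝ, (1 - δ) * ‖s • f + t • e‖ ^ 2 ≤ ‖A (s • f + t • e)‖ ^ 2 ∧
      ‖A (s • f + t • e)‖ ^ 2 ≤ (1 + δ) * ‖s • f + t • e‖ ^ 2) :
    inner ℝ f e - inner ℝ (A f) (A e) ≤ δ * (‖f‖ * ‖e‖) := by
  rcases eq_or_ne f 0 with rfl | hf
  · simp
  rcases eq_or_ne e 0 with rfl | he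
  · simp
  have hp : 0 < ‖f‖ * ‖e‖ := mul_pos (norm_pos_iff.2 hf) (norm_pos_iff.2 he)
  have h₁ := (h ‖e‖ ‖f‖).1
  have h₂ := (h ‖e‖ (-‖f‖)).2
  simp only [map_add, map_smul, norm_add_sq_real, norm_smul, inner_smul_left, inner_smul_right,
    Real.norm_eq_abs, mul_pow, sq_abs, neg_sq, conj_trivial] at h₁ h₂
  refine le_of_mul_le_mul_left ?_ hp
  linarith

/-- One step of iterative hard thresholding contracts the error by a factor `2 * δ`. -/
theorem norm_sub_le_of_threshold [FiniteDimensional ℝ E] [FiniteDimensional ℝ F]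
    (A : E →ₗ[ℝ] F) {δ : ℝ} {u x x' : E}
    (h : ∀ s t : ℝ, (1 - δ) * ‖s • (x' - u) + t • (x - u)‖ ^ 2 ≤
        ‖A (s • (x' - u) + t • (x - u))‖ ^ 2 ∧
      ‖A (s • (x' - u) + t • (x - u))‖ ^ 2 ≤ (1 + δ) * ‖s • (x' - u) + t • (x - u)‖ ^ 2)
    (hthresh : ‖x' - (x + LinearMap.adjoint A (A u - A x))‖ ≤
      ‖u - (x + LinearMap.adjoint A (A u - A x))‖) :
    ‖x' - u‖ ≤ 2 * δ * ‖x - u‖ := by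
  have hin := inner_sub_inner_map_le A h
  set e := x - u with he
  set f := x' - u with hf
  have hA : A u - A x = -A e := by rw [he, map_sub]; abel
  have h₁ : x' - (x + LinearMap.adjoint A (A u - A x)) = f - (e - LinearMap.adjoint A (A e)) := by
    rw [hA, he, hf, map_neg]; abel
  have h₂ : u - (x + LinearMap.adjoint A (A u - A x)) = -(e - LinearMap.adjoint A (A e)) := by
    rw [hA, he, map_neg]; abel
  rw [h₁, h₂, norm_neg] at hthresh
  have hsq := pow_le_pow_left₀ (norm_nonneg _) hthresh 2
  rw [norm_sub_sq_real, inner_sub_right, LinearMap.adjoint_inner_right] at hsq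
  rcases eq_or_ne f 0 with h0 | h0
  · have hδ := h 0 1
    simp only [zero_smul, one_smul, zero_add] at hδ
    rw [h0, norm_zero]
    rcases eq_or_ne e 0 with h1 | h1
    · simp [h1]
    · have hpos : 0 < ‖e‖ := norm_pos_iff.2 h1
      have : 0 ≤ δ * ‖e‖ ^ 2 := by linarith [hδ.1, hδ.2]
      have : 0 ≤ δ := nonneg_of_mul_nonneg_left this (by positivity)
      positivity
  · refine le_of_mul_le_mul_left ?_ (norm_pos_iff.2 h0)
    nlinarith

end RestrictedIsometry

/-- The factor `2 * δ` is dominated by `√(δ / (1 - δ))`. -/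
theorem two_mul_le_sqrt_div_one_sub {δ : ℝ} (hδ : δ < 1) : 2 * δ ≤ √(δ / (1 - δ)) := by
  rcases le_or_gt δ 0 with h | h
  · exact (by linarith : 2 * δ ≤ 0).trans (Real.sqrt_nonneg _)
  · refine Real.le_sqrt_of_sq_le ?_
    rw [le_div_iff₀ (by linarith)]
    nlinarith [mul_nonneg h.le (sq_nonneg (2 * δ - 1))]

/-- conditionally global convergence of tensor iterative hard thresholding
under the tensor restricted isometry property of order `3r` with constant `δ < 1/2`,
assuming the thresholding condition `‖u^{n+1} - y^{n+1}‖ ≤ ‖u - y^{n+1}‖` on the iterates. -/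
theorem tiht_conditionally_global_convergence {d m : ℕ} (hd : 2 ≤ d)
    (n : Fin d → ℕ) (hn : ∀ i, 1 ≤ n i) (hm : 1 ≤ m)
    (A : TensorSpace d n →ₗ[ℝ] EuclideanSpace ℝ (Fin m))
    (r : Fin (d - 1) → ℕ) (δ : ℝ) (hδ : δ < 1 / 2)
    (hRIP : ∀ w : TensorSpace d n, ttRankLE n (fun μ => w μ) (fun i => 3 * r i) →
      (1 - δ) * ‖w‖ ^ 2 ≤ ‖A w‖ ^ 2 ∧ ‖A w‖ ^ 2 ≤ (1 + δ) * ‖w‖ ^ 2)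
    (u : TensorSpace d n) (hu : ttRankLE n (fun μ => u μ) r)
    (b : EuclideanSpace ℝ (Fin m)) (hb : b = A u)
    (useq : ℕ → TensorSpace d n) (hseq : ∀ k, ttRankLE n (fun μ => useq k μ) r)
    (hthresh : ∀ k,
      ‖useq (k + 1) - (useq k + (LinearMap.adjoint A) (b - A (useq k)))‖ ≤
        ‖u - (useq k + (LinearMap.adjoint A) (b - A (useq k)))‖) :
    Real.sqrt (δ / (1 - δ)) < 1 ∧
    (∀ k, ‖useq (k + 1) - u‖ ≤ Real.sqrt (δ / (1 - δ)) * ‖useq k - u‖) ∧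
    (∀ k, ‖useq k - u‖ ≤ Real.sqrt (δ / (1 - δ)) ^ k * ‖useq 0 - u‖) ∧
    Filter.Tendsto useq Filter.atTop (nhds u) := by
  have hρ : √(δ / (1 - δ)) < 1 := by
    rw [Real.sqrt_lt' one_pos, div_lt_iff₀ (by linarith)]
    linarith
  have hstep (k : ℕ) : ‖useq (k + 1) - u‖ ≤ √(δ / (1 - δ)) * ‖useq k - u‖ := by
    subst hb
    refine (norm_sub_le_of_threshold A (fun s t => ?_) (hthresh k)).trans
      (mul_le_mul_of_nonneg_right (two_mul_le_sqrt_div_one_sub (by linarith)) (norm_nonneg _))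
    have hw : s • (useq (k + 1) - u) + t • (useq k - u) =
        s • useq (k + 1) + t • useq k + (-(s + t)) • u := by module
    rw [hw]
    exact hRIP _ ((hseq (k + 1)).linearCombination (hseq k) hu s t _)
  have hpow (k : ℕ) : ‖useq k - u‖ ≤ √(δ / (1 - δ)) ^ k * ‖useq 0 - u‖ := by
    induction k with
    | zero => simp
    | succ k ih =>
      rw [pow_succ', mul_assoc]
      exact (hstep k).trans (mul_le_mul_of_nonneg_left ih (Real.sqrt_nonneg _))
  refine ⟨hρ, hstep, hpow, ?_⟩
  rw [tendsto_iff_norm_sub_tendsto_zero]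
  refine squeeze_zero (fun _ => norm_nonneg _) hpow ?_
  simpa using (tendsto_pow_atTop_nhds_zero_of_lt_one (Real.sqrt_nonneg _) hρ).mul_const
    ‖useq 0 - u‖
end

section
/- (TRIP for Gaussian maps, Tucker/HOSVD format.) There exists a universal constant C > 0 with the following property. Fix d ≥ 2, dimensions n_1,…,n_d ≥ 1, a rank tuple (r_1,…,r_d), and δ, ε ∈ (0,1), and set n = max_i n_i and r = max_i r_i. Let A_ω : ℋ_d → ℝ^m be the random linear map (A_ω u)_ℓ = Σ_μ ω(ℓ,μ) u(μ), where the entries ω(ℓ, μ_1,…,μ_d), ℓ ∈ {1,…,m}, μ_i ∈ {1,…,n_i}, are independent Gaussian random variables with mean 0 and variance 1/m (i.e., ω is drawn from the product Gaussian measure). If m ≥ C δ^{-2} max{ (r^d + d n r) log d, log(1/ε) }, then with probability at least 1 − ε the following event holds: for every u ∈ ℋ_d of Tucker rank at most (r_1,…,r_d), (1−δ)‖u‖² ≤ ‖A_ω u‖² ≤ (1+δ)‖u‖². (The event in question is measurable, being closed in the entries of ω.) -/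
open MeasureTheory ProbabilityTheory

section

open scoped Matrix Matrix.Norms.L2Operator

/-- The matrices `U j` applied to all the modes of the tensor `S`. -/
def modeProd {d : ℕ} {a b : Fin d → ℕ} (U : ∀ j, Matrix (Fin (b j)) (Fin (a j)) ℝ)
    (S : (∀ j, Fin (a j)) → ℝ) (μ : ∀ j, Fin (b j)) : ℝ :=
  ∑ k, (∏ j, U j (μ j) (k j)) * S k

theorem Fin.sum_pi_cons {M : Type*} [AddCommMonoid M] {d : ℕ} {a : Fin (d + 1) → ℕ}
    (f : (∀ j, Fin (a j)) → M) :
    ∑ k, f k = ∑ k₀, ∑ k' : ∀ j : Fin d, Fin (a j.succ), f (Fin.cons k₀ k') := by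
  rw [← (Fin.consEquiv fun j => Fin (a j)).sum_comp, Fintype.sum_prod_type]
  rfl

theorem modeProd_cons {d : ℕ} {a b : Fin (d + 1) → ℕ}
    (U : ∀ j, Matrix (Fin (b j)) (Fin (a j)) ℝ) (S : (∀ j, Fin (a j)) → ℝ)
    (μ₀ : Fin (b 0)) (μ : ∀ j : Fin d, Fin (b j.succ)) :
    modeProd U S (Fin.cons μ₀ μ) =
      modeProd (fun j : Fin d => U j.succ) (fun k => ∑ k₀, U 0 μ₀ k₀ * S (Fin.cons k₀ k)) μ := by
  simp only [modeProd, Fin.sum_pi_cons, Fin.prod_univ_succ, Fin.cons_zero, Fin.cons_succ,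
    Finset.mul_sum]
  rw [Finset.sum_comm]
  refine Finset.sum_congr rfl fun _ _ => Finset.sum_congr rfl fun _ _ => ?_
  ring

theorem Matrix.sum_sq_mulVec_le {a b : ℕ} (U : Matrix (Fin b) (Fin a) ℝ) (hU : ‖U‖ ≤ 1)
    (x : Fin a → ℝ) : ∑ i, (∑ j, U i j * x j) ^ 2 ≤ ∑ j, x j ^ 2 := by
  have h := U.l2_opNorm_mulVec (WithLp.toLp 2 x)
  have h2 : ‖(EuclideanSpace.equiv (Fin b) ℝ).symm (U *ᵥ x)‖ ≤ ‖WithLp.toLp 2 x‖ :=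
    h.trans (mul_le_of_le_one_left (norm_nonneg _) hU)
  have h3 := pow_le_pow_left₀ (norm_nonneg _) h2 2
  simpa [EuclideanSpace.norm_sq_eq, Matrix.mulVec, dotProduct] using h3

theorem sum_sq_modeProd_le {d : ℕ} {a b : Fin d → ℕ} (U : ∀ j, Matrix (Fin (b j)) (Fin (a j)) ℝ)
    (hU : ∀ j, ‖U j‖ ≤ 1) (S : (∀ j, Fin (a j)) → ℝ) :
    ∑ μ, modeProd U S μ ^ 2 ≤ ∑ k, S k ^ 2 := by
  induction d with
  | zero => simp [modeProd, Subsingleton.elim _ (default : ∀ j, Fin (a j))]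
  | succ d ih =>
    simp only [Fin.sum_pi_cons, modeProd_cons]
    calc _ ≤ ∑ μ₀, ∑ k, (∑ k₀, U 0 μ₀ k₀ * S (Fin.cons k₀ k)) ^ 2 :=
          Finset.sum_le_sum fun μ₀ _ => ih _ (fun j => hU j.succ) _
      _ = ∑ k, ∑ μ₀, (∑ k₀, U 0 μ₀ k₀ * S (Fin.cons k₀ k)) ^ 2 := Finset.sum_comm
      _ ≤ ∑ k, ∑ k₀, S (Fin.cons k₀ k) ^ 2 :=
          Finset.sum_le_sum fun k _ => (U 0).sum_sq_mulVec_le (hU 0) _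
      _ = _ := Finset.sum_comm

theorem modeProd_modeProd {d : ℕ} {a b c : Fin d → ℕ}
    (U : ∀ j, Matrix (Fin (b j)) (Fin (a j)) ℝ) (V : ∀ j, Matrix (Fin (a j)) (Fin (c j)) ℝ)
    (S : (∀ j, Fin (c j)) → ℝ) :
    modeProd U (modeProd V S) = modeProd (fun j => U j * V j) S := by
  funext μ
  simp only [modeProd, Finset.mul_sum, Matrix.mul_apply]
  rw [Finset.sum_comm]
  refine Finset.sum_congr rfl fun k _ => ?_
  rw [Finset.prod_univ_sum, Fintype.piFinset_univ, Finset.sum_mul]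
  refine Finset.sum_congr rfl fun l _ => ?_
  rw [Finset.prod_mul_distrib, mul_assoc]

theorem modeProd_eq_self {d : ℕ} {n : Fin d → ℕ} (P : ∀ j, Matrix (Fin (n j)) (Fin (n j)) ℝ)
    (u : (∀ j, Fin (n j)) → ℝ)
    (h : ∀ j μ, ∑ a, P j (μ j) a * u (Function.update μ j a) = u μ) : modeProd P u = u := by
  induction d with
  | zero =>
    funext μ
    simp [modeProd, Subsingleton.elim _ μ]
  | succ d ih =>
    funext μ
    rw [← Fin.cons_self_tail μ, modeProd_cons]
    have h0 : (fun k => ∑ k₀, P 0 (μ 0) k₀ * u (Fin.cons k₀ k)) =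
        fun k => u (Fin.cons (μ 0) k) := by
      funext k
      simpa using h 0 (Fin.cons (μ 0) k)
    rw [h0, ih (fun j => P j.succ)]
    intro j k
    simpa [Fin.cons_update] using h j.succ (Fin.cons (μ 0) k)

theorem Matrix.exists_contraction_of_rank_le {a r : ℕ} {ι : Type*} [Fintype ι]
    (M : Matrix (Fin a) ι ℝ) (hM : M.rank ≤ r) :
    ∃ U : Matrix (Fin a) (Fin r) ℝ, ‖U‖ ≤ 1 ∧ U * Uᵀ * M = M := by
  classical
  let w : ι → EuclideanSpace ℝ (Fin a) := fun c => WithLp.toLp 2 (M.col c)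
  let V : Submodule ℝ (EuclideanSpace ℝ (Fin a)) := Submodule.span ℝ (Set.range w)
  have hV : Module.finrank ℝ V ≤ r := by
    refine le_trans (le_of_eq ?_) hM
    rw [Matrix.rank_eq_finrank_span_cols]
    have : V = (Submodule.span ℝ (Set.range M.col)).map
        (WithLp.linearEquiv 2 ℝ (Fin a → ℝ)).symm.toLinearMap := by
      rw [Submodule.map_span, ← Set.range_comp]
      rfl
    rw [this]
    exact LinearEquiv.finrank_map_eq _ _
  let b := stdOrthonormalBasis ℝ V
  let e : Fin r → EuclideanSpace ℝ (Fin a) := fun k =>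
    if h : k.val < Module.finrank ℝ V then (b ⟨k, h⟩ : EuclideanSpace ℝ (Fin a)) else 0
  let U : Matrix (Fin a) (Fin r) ℝ := Matrix.of fun i k => e k i
  have hUU : Uᴴ * U = Matrix.diagonal fun k : Fin r =>
      if k.val < Module.finrank ℝ V then (1 : ℝ) else 0 := by
    ext k l
    have : (Uᴴ * U) k l = inner ℝ (e k) (e l) := by
      simp only [U, Matrix.mul_apply, PiLp.inner_apply, Matrix.conjTranspose_apply,
        Matrix.of_apply]
      exact Finset.sum_congr rfl fun _ _ => mul_comm _ _
    rw [this]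
    have hb := orthonormal_iff_ite.1 b.orthonormal
    by_cases hk : k.val < Module.finrank ℝ V <;> by_cases hl : l.val < Module.finrank ℝ V
    · have := hb ⟨k, hk⟩ ⟨l, hl⟩
      rw [Submodule.coe_inner] at this
      simp [e, hk, hl, this, Matrix.diagonal_apply, Fin.ext_iff]
    all_goals
      simp only [e, hk, hl, dite_true, dite_false, inner_zero_left, inner_zero_right,
        Matrix.diagonal_apply, if_true, if_false]
      grind
  refine ⟨U, ?_, ?_⟩
  · have h := U.l2_opNorm_conjTranspose_mul_self
    rw [hUU, Matrix.l2_opNorm_diagonal] at h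
    have : ‖U‖ * ‖U‖ ≤ 1 := by
      rw [← h, pi_norm_le_iff_of_nonneg zero_le_one]
      intro k
      split_ifs <;> simp
    nlinarith [norm_nonneg U]
  · ext i c
    have hw : w c ∈ V := Submodule.subset_span ⟨c, rfl⟩
    have hsum := congrArg (fun v : V => (v : EuclideanSpace ℝ (Fin a)) i)
      (b.sum_repr' ⟨w c, hw⟩)
    simp only [Submodule.coe_sum, Submodule.coe_smul, Submodule.coe_inner] at hsum
    have hext : ∑ k : Fin r, inner ℝ (e k) (w c) * e k i = M i c := by
      have hw' : w c i = M i c := rfl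
      rw [← hw', ← hsum]
      simp only [WithLp.ofLp_sum, Finset.sum_apply, PiLp.smul_apply, smul_eq_mul]
      symm
      refine Finset.sum_of_injOn (Fin.castLE hV) (Fin.castLE_injective hV).injOn (by simp) ?_ ?_
      · intro k _ hk
        have : ¬ k.val < Module.finrank ℝ V := fun h => hk ⟨⟨k, h⟩, by simp, rfl⟩
        simp [e, this]
      · intro k _
        simp [e]
    rw [← hext, Matrix.mul_assoc, Matrix.mul_apply]
    refine Finset.sum_congr rfl fun k _ => ?_
    rw [mul_comm, Matrix.mul_apply]
    congr 1
    simp only [PiLp.inner_apply]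
    exact Finset.sum_congr rfl fun _ _ => mul_comm _ _

/-- A tensor of Tucker rank at most `r` is the mode product of contractions with a core tensor
that is no larger in norm. -/
theorem tuckerRankLE.exists_modeProd {d : ℕ} {n r : Fin d → ℕ} {u : (∀ j, Fin (n j)) → ℝ}
    (hu : tuckerRankLE n u r) {R : ℕ} (hR : ∀ j, r j ≤ R) :
    ∃ (U : ∀ j, Matrix (Fin (n j)) (Fin R) ℝ) (S : (Fin d → Fin R) → ℝ),
      (∀ j, ‖U j‖ ≤ 1) ∧ ∑ k, S k ^ 2 ≤ ∑ μ, u μ ^ 2 ∧ modeProd U S = u := by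
  choose U hU hUM using fun j =>
    (modeMat n u j).exists_contraction_of_rank_le ((hu j).trans (hR j))
  refine ⟨U, modeProd (fun j => (U j)ᵀ) u, hU, sum_sq_modeProd_le _ (fun j => ?_) u, ?_⟩
  · rw [← Matrix.conjTranspose_eq_transpose_of_trivial, Matrix.l2_opNorm_conjTranspose]
    exact hU j
  · rw [modeProd_modeProd]
    refine modeProd_eq_self _ _ fun j μ => ?_
    have h := congrFun (congrFun (hUM j) (μ j)) fun i => μ i.val
    rw [Matrix.mul_apply] at h
    have hupd : ∀ a, modeMat n u j a (fun i => μ i.val) = u (Function.update μ j a) := by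
      intro a
      unfold modeMat
      congr 1
      funext i
      by_cases hi : i = j
      · subst hi; simp
      · simp [hi]
    simp only [hupd, Function.update_eq_self] at h
    exact h
open Metric Set Module in
open scoped Function ENNReal in
/-- An `ε`-separated subset of the unit ball has at most `(1 + 2 / ε) ^ dim` elements. -/
theorem card_le_of_separated_unitBall {E : Type*} [NormedAddCommGroup E] [NormedSpace ℝ E]
    [FiniteDimensional ℝ E] {ε : ℝ} (hε : 0 < ε) (s : Finset E) (hs : ∀ c ∈ s, ‖c‖ ≤ 1)
    (h : ∀ c ∈ s, ∀ d ∈ s, c ≠ d → ε ≤ ‖c - d‖) :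
    (s.card : ℝ) ≤ (1 + 2 / ε) ^ finrank ℝ E := by
  borelize E
  let μ : Measure E := Measure.addHaar
  have hε2 : 0 < ε / 2 := by positivity
  have hρ : 0 < 1 + ε / 2 := by positivity
  have D : (s : Set E).Pairwise (Disjoint on fun c => ball c (ε / 2)) := by
    rintro c hc d hd hcd
    apply ball_disjoint_ball
    rw [dist_eq_norm, add_halves]
    exact h c hc d hd hcd
  have A_subset : (⋃ c ∈ s, ball c (ε / 2)) ⊆ ball (0 : E) (1 + ε / 2) := by
    refine iUnion₂_subset fun x hx => ball_subset_ball' ?_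
    rw [dist_zero_right]
    linarith [hs x hx]
  have I : (s.card : ℝ≥0∞) * ENNReal.ofReal ((ε / 2) ^ finrank ℝ E) * μ (ball 0 1) ≤
      ENNReal.ofReal ((1 + ε / 2) ^ finrank ℝ E) * μ (ball 0 1) := by
    rw [← μ.addHaar_ball_of_pos 0 hρ]
    refine le_trans (le_of_eq ?_) (measure_mono A_subset)
    rw [measure_biUnion_finset D fun c _ => measurableSet_ball]
    simp only [μ.addHaar_ball_of_pos _ hε2, Finset.sum_const, nsmul_eq_mul, mul_assoc]
  have J := (ENNReal.mul_le_mul_iff_left (measure_ball_pos _ _ zero_lt_one).ne'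
    measure_ball_lt_top.ne).1 I
  have K := ENNReal.toReal_le_of_le_ofReal (by positivity) J
  rw [ENNReal.toReal_mul, ENNReal.toReal_natCast, ENNReal.toReal_ofReal (by positivity),
    ← le_div_iff₀ (by positivity), ← div_pow] at K
  have hdiv : (1 + ε / 2) / (ε / 2) = 1 + 2 / ε := by
    field_simp
    ring
  rwa [hdiv] at K

/-- A finite `ε`-net of the unit ball, contained in the unit ball. -/
structure IsUnitBallNet {E : Type*} [NormedAddCommGroup E] (ε : ℝ) (s : Finset E) : Prop where
  norm_le : ∀ c ∈ s, ‖c‖ ≤ 1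
  exists_near : ∀ x : E, ‖x‖ ≤ 1 → ∃ c ∈ s, ‖x - c‖ ≤ ε

open Module in
theorem exists_isUnitBallNet (E : Type*) [NormedAddCommGroup E] [NormedSpace ℝ E]
    [FiniteDimensional ℝ E] {ε : ℝ} (hε : 0 < ε) :
    ∃ s : Finset E, IsUnitBallNet ε s ∧ (s.card : ℝ) ≤ (1 + 2 / ε) ^ finrank ℝ E := by
  classical
  let P : Finset E → Prop := fun s =>
    (∀ c ∈ s, ‖c‖ ≤ 1) ∧ ∀ c ∈ s, ∀ d ∈ s, c ≠ d → ε ≤ ‖c - d‖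
  have hbdd : BddAbove {k : ℕ | ∃ s, P s ∧ s.card = k} := by
    refine ⟨⌊(1 + 2 / ε) ^ finrank ℝ E⌋₊, ?_⟩
    rintro _ ⟨s, hs, rfl⟩
    exact Nat.le_floor (card_le_of_separated_unitBall hε s hs.1 hs.2)
  obtain ⟨s, hs, hcard⟩ := Nat.sSup_mem (s := {k : ℕ | ∃ s, P s ∧ s.card = k})
    ⟨0, ∅, by simp [P], rfl⟩ hbdd
  refine ⟨s, ⟨hs.1, fun x hx => ?_⟩, card_le_of_separated_unitBall hε s hs.1 hs.2⟩
  by_contra! hfar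
  have hxs : x ∉ s := fun hmem => by
    have := hfar x hmem
    simp at this
    linarith
  have hP : P (insert x s) := by
    refine ⟨by simpa [hx] using hs.1, fun c hc d hd hcd => ?_⟩
    rcases Finset.mem_insert.1 hc with hcx | hcs <;> rcases Finset.mem_insert.1 hd with hdx | hds
    · exact absurd (hcx.trans hdx.symm) hcd
    · exact hcx ▸ (hfar d hds).le
    · rw [hdx, norm_sub_rev]
      exact (hfar c hcs).le
    · exact hs.2 c hcs d hds hcd
  have hle := le_csSup hbdd ⟨_, hP, rfl⟩
  rw [Finset.card_insert_of_notMem hxs] at hle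
  lia

theorem IsUnitBallNet.abs_le {E : Type*} [NormedAddCommGroup E] [NormedSpace ℝ E]
    [FiniteDimensional ℝ E] {ε τ : ℝ} {s : Finset E} (hs : IsUnitBallNet ε s) (hε : 0 ≤ ε)
    (hε1 : ε < 1) (f : E →ₗ[ℝ] ℝ) (hf : ∀ c ∈ s, |f c| ≤ τ) {x : E} (hx : ‖x‖ ≤ 1) :
    |f x| ≤ τ * (1 - ε)⁻¹ := by
  let g : E →L[ℝ] ℝ := LinearMap.toContinuousLinearMap f
  have hτ : 0 ≤ τ := by
    obtain ⟨c, hc, -⟩ := hs.exists_near 0 (by simp)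
    exact (abs_nonneg _).trans (hf c hc)
  have hg : ‖g‖ ≤ τ + ε * ‖g‖ := by
    refine ContinuousLinearMap.opNorm_le_of_unit_norm (by positivity) fun y hy => ?_
    obtain ⟨c, hc, hyc⟩ := hs.exists_near y hy.le
    calc ‖g y‖ = ‖g c + g (y - c)‖ := by rw [← map_add]; congr 2; abel
      _ ≤ ‖g c‖ + ‖g (y - c)‖ := norm_add_le _ _
      _ ≤ τ + ‖g‖ * ‖y - c‖ := add_le_add (hf c hc) (g.le_opNorm _)
      _ ≤ τ + ε * ‖g‖ := by nlinarith [norm_nonneg g]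
  have h1 : ‖g‖ ≤ τ * (1 - ε)⁻¹ := by
    rw [← div_eq_mul_inv, le_div_iff₀ (by linarith)]
    linarith
  calc |f x| = ‖g x‖ := rfl
    _ ≤ ‖g‖ * ‖x‖ := g.le_opNorm x
    _ ≤ ‖g‖ * 1 := by gcongr
    _ ≤ _ := by simpa using h1

theorem MultilinearMap.abs_le_of_isUnitBallNet {ι : Type*} [Fintype ι] {E : ι → Type*}
    [∀ i, NormedAddCommGroup (E i)] [∀ i, NormedSpace ℝ (E i)] [∀ i, FiniteDimensional ℝ (E i)]
    {ε τ : ℝ} {s : ∀ i, Finset (E i)} (hs : ∀ i, IsUnitBallNet ε (s i)) (hε : 0 ≤ ε)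
    (hε1 : ε < 1) (F : MultilinearMap ℝ E ℝ) (hF : ∀ x, (∀ i, x i ∈ s i) → |F x| ≤ τ)
    {x : ∀ i, E i} (hx : ∀ i, ‖x i‖ ≤ 1) :
    |F x| ≤ τ * (1 - ε)⁻¹ ^ Fintype.card ι := by
  classical
  suffices H : ∀ t : Finset ι, ∀ x : ∀ i, E i, (∀ i ∈ t, ‖x i‖ ≤ 1) → (∀ i ∉ t, x i ∈ s i) →
      |F x| ≤ τ * (1 - ε)⁻¹ ^ t.card from
    H Finset.univ x (fun i _ => hx i) (by simp)
  intro t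
  induction t using Finset.induction_on with
  | empty => exact fun x _ h => by simpa using hF x fun i => h i (by simp)
  | insert i t hi ih =>
    intro x hxt hxs
    have := (hs i).abs_le hε hε1 (F.toLinearMap x i) (τ := τ * (1 - ε)⁻¹ ^ t.card)
      (fun c hc => ih _ (fun j hj => ?_) (fun j hj => ?_)) (hxt i (Finset.mem_insert_self _ _))
    · rw [Finset.card_insert_of_notMem hi, pow_succ, ← mul_assoc]
      simpa using this
    · rw [Function.update_of_ne (by rintro rfl; exact hi hj)]
      exact hxt j (Finset.mem_insert_of_mem hj)
    · by_cases hij : j = i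
      · subst hij; simpa using hc
      · rw [Function.update_of_ne hij]
        exact hxs j (by simp [hij, hj])

/-- `modeProd` as a multilinear map in the matrices. -/
noncomputable def modeProdMultilinear {d : ℕ} {a b : Fin d → ℕ} (S : (∀ j, Fin (a j)) → ℝ) :
    MultilinearMap ℝ (fun j => Matrix (Fin (b j)) (Fin (a j)) ℝ) ((∀ j, Fin (b j)) → ℝ) :=
  MultilinearMap.pi fun μ => ∑ k, S k •
    (MultilinearMap.mkPiAlgebra ℝ (Fin d) ℝ).compLinearMap fun j =>
      Matrix.entryLinearMap ℝ ℝ (μ j) (k j)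

theorem modeProdMultilinear_apply {d : ℕ} {a b : Fin d → ℕ} (S : (∀ j, Fin (a j)) → ℝ)
    (U : ∀ j, Matrix (Fin (b j)) (Fin (a j)) ℝ) :
    modeProdMultilinear S U = modeProd U S := by
  funext μ
  simp [modeProdMultilinear, modeProd, mul_comm]

/-- `modeProd` as a linear map in the core tensor. -/
def modeProdLinear {d : ℕ} {a b : Fin d → ℕ} (U : ∀ j, Matrix (Fin (b j)) (Fin (a j)) ℝ) :
    EuclideanSpace ℝ (∀ j, Fin (a j)) →ₗ[ℝ] (∀ j, Fin (b j)) → ℝ where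
  toFun S := modeProd U S
  map_add' S T := by
    funext μ
    simp [modeProd, mul_add, Finset.sum_add_distrib]
  map_smul' c S := by
    funext μ
    simp [modeProd, Finset.mul_sum, mul_left_comm]

theorem abs_modeProd_le_of_isUnitBallNet {d : ℕ} {a b : Fin d → ℕ} {ε τ : ℝ} (hε : 0 ≤ ε)
    (hε1 : ε < 1) {s : ∀ j, Finset (Matrix (Fin (b j)) (Fin (a j)) ℝ)}
    (hs : ∀ j, IsUnitBallNet ε (s j)) {s₀ : Finset (EuclideanSpace ℝ (∀ j, Fin (a j)))}
    (hs₀ : IsUnitBallNet ε s₀) (φ : ((∀ j, Fin (b j)) → ℝ) →ₗ[ℝ] ℝ)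
    (hφ : ∀ U, (∀ j, U j ∈ s j) → ∀ S ∈ s₀, |φ (modeProd U S)| ≤ τ)
    {U : ∀ j, Matrix (Fin (b j)) (Fin (a j)) ℝ} (hU : ∀ j, ‖U j‖ ≤ 1)
    {S : EuclideanSpace ℝ (∀ j, Fin (a j))} (hS : ‖S‖ ≤ 1) :
    |φ (modeProd U S)| ≤ τ * (1 - ε)⁻¹ ^ (d + 1) := by
  have h1 : ∀ T ∈ s₀, |φ (modeProd U T)| ≤ τ * (1 - ε)⁻¹ ^ d := fun T hT => by
    have h := MultilinearMap.abs_le_of_isUnitBallNet hs hε hε1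
      (φ.compMultilinearMap (modeProdMultilinear T)) (τ := τ) (fun V hV => by
        simpa [modeProdMultilinear_apply] using hφ V hV T hT) hU
    simpa [modeProdMultilinear_apply] using h
  have h2 := hs₀.abs_le hε hε1 (φ ∘ₗ modeProdLinear U) h1 hS
  rw [pow_succ, ← mul_assoc]
  exact h2

/-- The deviation of `∑ l, (∑ i, ω (l, i) * x i) ^ 2` from `∑ i, x i ^ 2`, polarized. -/
def gramDeviation {κ ι : Type*} [Fintype κ] [Fintype ι] (ω : κ × ι → ℝ) :
    (ι → ℝ) →ₗ[ℝ] (ι → ℝ) →ₗ[ℝ] ℝ :=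
  LinearMap.mk₂ ℝ
    (fun x y => ∑ l, (∑ i, ω (l, i) * x i) * (∑ i, ω (l, i) * y i) - ∑ i, x i * y i)
    (fun x x' y => by simp only [Pi.add_apply, mul_add, add_mul, Finset.sum_add_distrib]; ring)
    (fun c x y => by
      simp only [Pi.smul_apply, smul_eq_mul, mul_sub, Finset.mul_sum, Finset.sum_mul,
        mul_assoc, mul_left_comm])
    (fun x y y' => by simp only [Pi.add_apply, mul_add, Finset.sum_add_distrib]; ring)
    (fun c x y => by
      simp only [Pi.smul_apply, smul_eq_mul, mul_sub, Finset.mul_sum, Finset.sum_mul,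
        mul_assoc, mul_left_comm])

theorem gramDeviation_apply {κ ι : Type*} [Fintype κ] [Fintype ι] (ω : κ × ι → ℝ)
    (x y : ι → ℝ) : gramDeviation ω x y =
      ∑ l, (∑ i, ω (l, i) * x i) * (∑ i, ω (l, i) * y i) - ∑ i, x i * y i := rfl

theorem gramDeviation_self {κ ι : Type*} [Fintype κ] [Fintype ι] (ω : κ × ι → ℝ)
    (x : ι → ℝ) : gramDeviation ω x x =
      ∑ l, (∑ i, ω (l, i) * x i) ^ 2 - ∑ i, x i ^ 2 := by
  simp only [gramDeviation_apply, pow_two]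

theorem gramDeviation_comm {κ ι : Type*} [Fintype κ] [Fintype ι] (ω : κ × ι → ℝ)
    (x y : ι → ℝ) : gramDeviation ω x y = gramDeviation ω y x := by
  simp only [gramDeviation_apply, mul_comm]

theorem abs_gramDeviation_le {κ ι : Type*} [Fintype κ] [Fintype ι] (ω : κ × ι → ℝ)
    {τ : ℝ} (hτ : 0 ≤ τ) {x y : ι → ℝ} (hx : ∑ i, x i ^ 2 ≤ 1) (hy : ∑ i, y i ^ 2 ≤ 1)
    (hadd : |gramDeviation ω (x + y) (x + y)| ≤ τ * ∑ i, (x + y) i ^ 2)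
    (hsub : |gramDeviation ω (x - y) (x - y)| ≤ τ * ∑ i, (x - y) i ^ 2) :
    |gramDeviation ω x y| ≤ τ := by
  have hpol : 4 * gramDeviation ω x y =
      gramDeviation ω (x + y) (x + y) - gramDeviation ω (x - y) (x - y) := by
    simp only [map_add, map_sub, LinearMap.add_apply, LinearMap.sub_apply]
    rw [gramDeviation_comm ω y x]
    ring
  have hpar : ∑ i, (x + y) i ^ 2 + ∑ i, (x - y) i ^ 2 =
      2 * ∑ i, x i ^ 2 + 2 * ∑ i, y i ^ 2 := by
    simp only [Finset.mul_sum, ← Finset.sum_add_distrib, Pi.add_apply, Pi.sub_apply]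
    exact Finset.sum_congr rfl fun _ _ => by ring
  have hle : τ * ∑ i, (x + y) i ^ 2 + τ * ∑ i, (x - y) i ^ 2 ≤ 4 * τ := by
    rw [← mul_add, hpar]
    nlinarith
  rw [abs_le] at hadd hsub ⊢
  constructor <;> linarith [hadd.1, hadd.2, hsub.1, hsub.2]

/-- The mode products of nets, together with a bound for their number. -/
theorem exists_finset_modeProd {d : ℕ} (n r : Fin d → ℕ) {ε : ℝ} (hε : 0 < ε) (hε1 : ε < 1) :
    ∃ T : Finset ((∀ j, Fin (n j)) → ℝ),
      (∀ x ∈ T, ∑ μ, x μ ^ 2 ≤ 1) ∧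
      (T.card : ℝ) ≤ (1 + 2 / ε) ^ (∏ j, r j + ∑ j, n j * r j) ∧
      ∀ (φ : ((∀ j, Fin (n j)) → ℝ) →ₗ[ℝ] ℝ) (τ : ℝ), (∀ x ∈ T, |φ x| ≤ τ) →
        ∀ U : ∀ j, Matrix (Fin (n j)) (Fin (r j)) ℝ, (∀ j, ‖U j‖ ≤ 1) →
        ∀ S : EuclideanSpace ℝ (∀ j, Fin (r j)), ‖S‖ ≤ 1 →
          |φ (modeProd U S)| ≤ τ * (1 - ε)⁻¹ ^ (d + 1) := by
  classical
  choose s hs hcard using fun j => exists_isUnitBallNet (Matrix (Fin (n j)) (Fin (r j)) ℝ) hε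
  obtain ⟨s₀, hs₀, hcard₀⟩ := exists_isUnitBallNet (EuclideanSpace ℝ (∀ j, Fin (r j))) hε
  refine ⟨(s₀ ×ˢ Fintype.piFinset s).image fun p => modeProd p.2 p.1, ?_, ?_, ?_⟩
  · intro x hx
    obtain ⟨⟨S, U⟩, hSU, rfl⟩ := Finset.mem_image.1 hx
    obtain ⟨hS, hU⟩ := Finset.mem_product.1 hSU
    refine (sum_sq_modeProd_le U (fun j => (hs j).norm_le _ (Fintype.mem_piFinset.1 hU j))
      S).trans ?_
    have h := pow_le_one₀ (n := 2) (norm_nonneg _) (hs₀.norm_le S hS)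
    simpa [EuclideanSpace.norm_sq_eq] using h
  · refine (Nat.cast_le.2 Finset.card_image_le).trans ?_
    rw [Finset.card_product, Fintype.card_piFinset, pow_add, Nat.cast_mul, Nat.cast_prod,
      ← Finset.prod_pow_eq_pow_sum]
    simp only [finrank_euclideanSpace, Fintype.card_pi, Fintype.card_fin] at hcard₀
    simp only [Module.finrank_matrix, Module.finrank_self, mul_one, Fintype.card_fin] at hcard
    exact mul_le_mul hcard₀ (Finset.prod_le_prod (fun _ _ => by positivity) fun j _ => hcard j)
      (by positivity) (by positivity)
  · intro φ τ hφ U hU S hS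
    refine abs_modeProd_le_of_isUnitBallNet hε.le hε1 hs hs₀ φ (fun V hV T hT => ?_) hU hS
    exact hφ _ (Finset.mem_image.2 ⟨(T, V), Finset.mem_product.2
      ⟨hT, Fintype.mem_piFinset.2 hV⟩, rfl⟩)

/-- Restricted isometry on tensors of bounded Tucker rank follows from finitely many bounds. -/
theorem exists_finset_tuckerRankLE_isometry {d : ℕ} (n : Fin d → ℕ) (R : ℕ) :
    ∃ Z : Finset ((∀ j, Fin (n j)) → ℝ),
      (Z.card : ℝ) ≤ 2 * ((8 * d + 9 : ℝ) ^ (R ^ d + ∑ j, n j * R)) ^ 2 ∧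
      ∀ {m : ℕ} (ω : Fin m × (∀ j, Fin (n j)) → ℝ) {τ : ℝ}, 0 ≤ τ →
        (∀ z ∈ Z, |∑ l, (∑ μ, ω (l, μ) * z μ) ^ 2 - ∑ μ, z μ ^ 2| ≤ τ * ∑ μ, z μ ^ 2) →
        ∀ (r : Fin d → ℕ), (∀ j, r j ≤ R) → ∀ u, tuckerRankLE n u r →
          |∑ l, (∑ μ, ω (l, μ) * u μ) ^ 2 - ∑ μ, u μ ^ 2| ≤ 2 * τ * ∑ μ, u μ ^ 2 := by
  classical
  set ε : ℝ := 1 / (4 * (d + 1)) with hεdef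
  have hd0 : (0 : ℝ) ≤ d := Nat.cast_nonneg d
  have hε : 0 < ε := by positivity
  have hε1 : ε ≤ 1 / 4 := by
    rw [hεdef]
    gcongr
    linarith
  have hε_inv : 1 + 2 / ε = 8 * d + 9 := by
    rw [hεdef]
    field_simp
    ring
  have hpow : (1 - ε)⁻¹ ^ (d + 1) * (1 - ε)⁻¹ ^ (d + 1) ≤ 2 := by
    have h := one_add_mul_le_pow (a := -ε) (by linarith) (2 * (d + 1))
    rw [← pow_add, ← two_mul, inv_pow, inv_le_comm₀ (pow_pos (by linarith) _) two_pos]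
    refine le_trans (le_of_eq ?_) h
    rw [hεdef]
    push_cast
    field_simp
    ring
  obtain ⟨T, hT, hTcard, hTφ⟩ := exists_finset_modeProd n (fun _ => R) hε (by linarith)
  rw [hε_inv] at hTcard
  simp only [Finset.prod_const, Finset.card_univ, Fintype.card_fin] at hTcard
  refine ⟨(T ×ˢ T).image (fun p => p.1 + p.2) ∪ (T ×ˢ T).image (fun p => p.1 - p.2), ?_, ?_⟩
  · calc _ ≤ (((T.card * T.card + T.card * T.card : ℕ)) : ℝ) := by
          refine Nat.cast_le.2 ((Finset.card_union_le _ _).trans ?_)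
          refine add_le_add (Finset.card_image_le.trans ?_) (Finset.card_image_le.trans ?_) <;>
            rw [Finset.card_product]
      _ = 2 * (T.card : ℝ) ^ 2 := by
          push_cast
          ring
      _ ≤ _ := by gcongr
  · intro m ω τ hτ hZ r hr u hu
    have hZ' : ∀ x ∈ T, ∀ y ∈ T, |gramDeviation ω x y| ≤ τ := fun x hx y hy => by
      refine abs_gramDeviation_le ω hτ (hT x hx) (hT y hy) ?_ ?_ <;> rw [gramDeviation_self]
      · exact hZ _ (Finset.mem_union_left _ (Finset.mem_image.2
          ⟨(x, y), Finset.mem_product.2 ⟨hx, hy⟩, rfl⟩))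
      · exact hZ _ (Finset.mem_union_right _ (Finset.mem_image.2
          ⟨(x, y), Finset.mem_product.2 ⟨hx, hy⟩, rfl⟩))
    obtain ⟨U, S, hU, hS, rfl⟩ := hu.exists_modeProd hr
    set q := (1 - ε)⁻¹ ^ (d + 1)
    have hball : ∀ S' : EuclideanSpace ℝ (Fin d → Fin R), ‖S'‖ ≤ 1 →
        |gramDeviation ω (modeProd U S') (modeProd U S')| ≤ 2 * τ := fun S' hS' => by
      refine (hTφ (gramDeviation ω (modeProd U S')) (τ * q) (fun y hy => ?_) U hU S' hS').trans ?_
      · rw [gramDeviation_comm]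
        exact hTφ (gramDeviation ω y) τ (fun x hx => hZ' y hy x hx) U hU S' hS'
      · rw [mul_assoc, mul_comm 2]
        exact mul_le_mul_of_nonneg_left hpow hτ
    rw [← gramDeviation_self]
    let S₁ : EuclideanSpace ℝ (Fin d → Fin R) := WithLp.toLp 2 S
    have hnorm : ‖S₁‖ ^ 2 = ∑ k, S k ^ 2 := by simp [S₁, EuclideanSpace.norm_sq_eq]
    have hscale : modeProd U S = ‖S₁‖ • modeProd U (‖S₁‖⁻¹ • S₁ : EuclideanSpace ℝ _) := by
      change modeProdLinear U S₁ = ‖S₁‖ • modeProdLinear U (‖S₁‖⁻¹ • S₁)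
      rw [← map_smul]
      rcases eq_or_ne S₁ 0 with h | h
      · simp [h]
      · rw [smul_inv_smul₀ (norm_ne_zero_iff.2 h)]
    have hunit : ‖‖S₁‖⁻¹ • S₁‖ ≤ 1 := by
      rw [norm_smul, norm_inv, norm_norm]
      exact inv_mul_le_one
    calc |gramDeviation ω (modeProd U S) (modeProd U S)|
        = ‖S₁‖ ^ 2 * |gramDeviation ω (modeProd U (‖S₁‖⁻¹ • S₁ : EuclideanSpace ℝ _))
            (modeProd U (‖S₁‖⁻¹ • S₁ : EuclideanSpace ℝ _))| := by
          rw [hscale]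
          simp only [map_smul, LinearMap.smul_apply, smul_eq_mul, abs_mul, abs_norm]
          ring
      _ ≤ ‖S₁‖ ^ 2 * (2 * τ) := by
          gcongr
          exact hball _ hunit
      _ ≤ 2 * τ * ∑ μ, modeProd U S μ ^ 2 := by
          rw [hnorm, mul_comm]
          gcongr

end

theorem gaussianReal_pi_map_linear {ι : Type*} [Fintype ι] (v : NNReal) (x : ι → ℝ) :
    (Measure.pi fun _ : ι => gaussianReal 0 v).map (fun z => ∑ i, z i * x i) =
      gaussianReal 0 (∑ i, Real.nnabs (x i) ^ 2 * v) := by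
  have hmap : (Measure.pi fun _ : ι => gaussianReal 0 v).map (fun z => ∑ i, z i * x i) =
      (Measure.pi fun i : ι => gaussianReal 0 (Real.nnabs (x i) ^ 2 * v)).map
        (fun p => ∑ i, p i) := by
    have hi : ∀ i : ι, (gaussianReal 0 v).map (· * x i) =
        gaussianReal 0 (Real.nnabs (x i) ^ 2 * v) := fun i => by
      rw [gaussianReal_map_mul_const, mul_zero]
      congr 2
      ext
      simp
    have : ∀ i : ι, SigmaFinite ((gaussianReal 0 v).map (· * x i)) := fun i => by
      rw [hi]; infer_instance
    have h := Measure.pi_map_pi (μ := fun _ : ι => gaussianReal 0 v)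
      (f := fun i y => y * x i) (fun i => by fun_prop)
    simp only [hi] at h
    rw [← h, Measure.map_map (by fun_prop) (by fun_prop)]
    rfl
  rw [hmap]
  have : IsProbabilityMeasure ((Measure.pi fun i : ι =>
      gaussianReal 0 (Real.nnabs (x i) ^ 2 * v)).map (fun p => ∑ i, p i)) :=
    Measure.isProbabilityMeasure_map (by fun_prop)
  refine Measure.ext_of_charFun ?_
  rw [charFun_map_sum_pi_eq_prod]
  funext t
  simp only [Finset.prod_apply, charFun_gaussianReal, ← Complex.exp_sum]
  congr 1
  push_cast
  simp [Finset.sum_mul, Finset.sum_div]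

theorem mgf_sq_gaussianReal {v : NNReal} (hv : v ≠ 0) {t : ℝ} (ht : 2 * (v * t) < 1) :
    mgf (fun x => x ^ 2) (gaussianReal 0 v) t = (√(1 - 2 * (v * t)))⁻¹ := by
  have hv0 : (0 : ℝ) < v := by exact_mod_cast pos_iff_ne_zero.2 hv
  have h1 : ∀ x : ℝ, gaussianPDFReal 0 v x • Real.exp (t * x ^ 2) =
      (√(2 * Real.pi * v))⁻¹ * Real.exp (-((1 - 2 * (v * t)) / (2 * v)) * x ^ 2) := fun x => by
    rw [gaussianPDFReal_def, smul_eq_mul, mul_assoc, ← Real.exp_add]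
    congr 2
    field_simp
    ring
  rw [mgf, integral_gaussianReal_eq_integral_smul hv]
  simp only [h1]
  rw [integral_const_mul, integral_gaussian, div_div_eq_mul_div, Real.sqrt_div' _ (by linarith),
    show Real.pi * (2 * v) = 2 * Real.pi * v by ring]
  have : √(2 * Real.pi * v) ≠ 0 := by positivity
  field_simp

theorem inv_sqrt_one_sub_two_mul_le {l : ℝ} (hl : |l| ≤ 1 / 8) :
    (√(1 - 2 * l))⁻¹ ≤ Real.exp (l + 2 * l ^ 2) := by
  obtain ⟨h1, h2⟩ := abs_le.1 hl
  have hexp : 1 + 2 * l + 4 * l ^ 2 + (if 0 ≤ l then 2 * l ^ 2 else 0) ≤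
      Real.exp (2 * l + 4 * l ^ 2) := by
    split_ifs with h
    · have := Real.quadratic_le_exp_of_nonneg (x := 2 * l + 4 * l ^ 2) (by positivity)
      nlinarith [mul_nonneg h (sq_nonneg l), sq_nonneg (l ^ 2)]
    · linarith [Real.add_one_le_exp (2 * l + 4 * l ^ 2)]
  rw [inv_le_comm₀ (Real.sqrt_pos.2 (by linarith)) (Real.exp_pos _), ← Real.exp_neg]
  refine Real.le_sqrt_of_sq_le ?_
  rw [← Real.exp_nat_mul, show ((2 : ℕ) : ℝ) * -(l + 2 * l ^ 2) = -(2 * l + 4 * l ^ 2) by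
    push_cast; ring, Real.exp_neg, inv_le_comm₀ (Real.exp_pos _) (by linarith)]
  refine le_trans ?_ hexp
  rw [inv_le_iff_one_le_mul₀ (by linarith)]
  split_ifs with h
  · nlinarith [mul_nonneg h (sq_nonneg l)]
  · have : 0 ≤ -l * l ^ 2 := mul_nonneg (by linarith) (sq_nonneg l)
    nlinarith

/-- Deviation bound for the square norm of a Gaussian map at a fixed vector. -/
theorem gaussian_sum_sq_deviation_le {ι : Type*} [Fintype ι] {m : ℕ} (hm : 1 ≤ m) (x : ι → ℝ)
    {τ : ℝ} (hτ : 0 ≤ τ) (hτ1 : τ ≤ 1 / 2) :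
    (Measure.pi fun _ : Fin m × ι => gaussianReal 0 (m : NNReal)⁻¹).real
      {ω | ¬ |∑ l, (∑ i, ω (l, i) * x i) ^ 2 - ∑ i, x i ^ 2| ≤ τ * ∑ i, x i ^ 2} ≤
      2 * Real.exp (-(m * τ ^ 2 / 8)) := by
  classical
  rcases eq_or_ne x 0 with rfl | hx
  · simp
    positivity
  set s : ℝ := ∑ i, x i ^ 2 with hs
  have hs0 : 0 < s := by
    obtain ⟨i, hi⟩ := Function.ne_iff.1 hx
    exact Finset.sum_pos' (fun i _ => sq_nonneg _) ⟨i, Finset.mem_univ _, by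
      have : x i ≠ 0 := hi
      positivity⟩
  have hm0 : (0 : ℝ) < m := by exact_mod_cast hm
  set γ := gaussianReal 0 (m : NNReal)⁻¹
  let ν : Measure (ι → ℝ) := Measure.pi fun _ => γ
  let P : Measure (Fin m → ι → ℝ) := Measure.pi fun _ => ν
  let v : NNReal := ∑ i, Real.nnabs (x i) ^ 2 * (m : NNReal)⁻¹
  have hv : (v : ℝ) = s / m := by
    simp [v, hs, div_eq_mul_inv, Finset.sum_mul]
  have hv0 : v ≠ 0 := by
    rw [← NNReal.coe_ne_zero, hv]
    positivity
  let g : (ι → ℝ) → ℝ := fun z => (∑ i, z i * x i) ^ 2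
  have hg : Measurable g := by fun_prop
  let X : Fin m → (Fin m → ι → ℝ) → ℝ := fun l ω => g (ω l)
  have hX : ∀ l, Measurable (X l) := fun l => by fun_prop
  have hind : iIndepFun X P := iIndepFun_pi fun _ => hg.aemeasurable
  have hcurry : (Measure.pi fun _ : Fin m × ι => γ).map
      (MeasurableEquiv.curry (Fin m) ι ℝ) = P := by
    have := Measure.infinitePi_map_curry (ι := Fin m) (κ := ι) fun _ _ => γ
    simpa only [Measure.infinitePi_eq_pi] using this
  have hmgf : ∀ (l : Fin m) (t : ℝ), 2 * (v * t) < 1 → mgf (X l) P t = (√(1 - 2 * (v * t)))⁻¹ := by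
    intro l t ht
    rw [← mgf_sq_gaussianReal hv0 ht, ← gaussianReal_pi_map_linear (m : NNReal)⁻¹ x,
      mgf_map (Measurable.aemeasurable (by fun_prop)) (by fun_prop)]
    change mgf _ _ _ = mgf g ν t
    have heval : AEMeasurable (Function.eval l) P := (measurable_pi_apply l).aemeasurable
    rw [← (measurePreserving_eval (fun _ : Fin m => ν) l).map_eq, mgf_map heval (by fun_prop)]
    rfl
  have hsum : ∀ c : ℝ, |c| ≤ 1 / 8 →
      Integrable (fun ω => Real.exp (c * m / s * (∑ l, X l) ω)) P ∧
      mgf (∑ l, X l) P (c * m / s) ≤ Real.exp (m * (c + 2 * c ^ 2)) := by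
    intro c hc
    have hvt : v * (c * m / s) = c := by
      rw [hv]
      field_simp
    have hlt : 2 * c < 1 := by linarith [le_abs_self c]
    have hmgf' : ∀ l, mgf (X l) P (c * m / s) = (√(1 - 2 * c))⁻¹ := fun l => by
      rw [hmgf l _ (by rwa [hvt]), hvt]
    refine ⟨hind.integrable_exp_mul_sum hX fun l _ => ?_, ?_⟩
    · refine not_imp_comm.1 integral_undef ?_
      change mgf (X l) P (c * m / s) ≠ 0
      rw [hmgf']
      have : 0 < √(1 - 2 * c) := Real.sqrt_pos.2 (by linarith)
      positivity
    · rw [hind.mgf_sum hX, Finset.prod_congr rfl fun l _ => hmgf' l, Finset.prod_const,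
        Finset.card_univ, Fintype.card_fin, Real.exp_nat_mul]
      gcongr
      exact inv_sqrt_one_sub_two_mul_le hc
  have hc : |τ / 4| ≤ 1 / 8 := by rw [abs_of_nonneg (by positivity)]; linarith
  have hc' : |-(τ / 4)| ≤ 1 / 8 := by rwa [abs_neg]
  have hup : P.real {ω | (1 + τ) * s ≤ (∑ l, X l) ω} ≤ Real.exp (-(m * τ ^ 2 / 8)) := by
    obtain ⟨hint, hle⟩ := hsum _ hc
    refine (measure_ge_le_exp_mul_mgf _ (by positivity) hint).trans ?_
    refine (mul_le_mul_of_nonneg_left hle (Real.exp_pos _).le).trans (le_of_eq ?_)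
    rw [← Real.exp_add]
    congr 1
    field_simp
    ring
  have hlow : P.real {ω | (∑ l, X l) ω ≤ (1 - τ) * s} ≤ Real.exp (-(m * τ ^ 2 / 8)) := by
    obtain ⟨hint, hle⟩ := hsum _ hc'
    refine (measure_le_le_exp_mul_mgf _ ?_ hint).trans ?_
    · rw [neg_mul, neg_div]
      exact neg_nonpos.2 (by positivity)
    refine (mul_le_mul_of_nonneg_left hle (Real.exp_pos _).le).trans (le_of_eq ?_)
    rw [← Real.exp_add]
    congr 1
    field_simp
    ring
  calc _ = P.real {ω | ¬ |(∑ l, X l) ω - s| ≤ τ * s} := by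
        rw [← hcurry, measureReal_def, measureReal_def, MeasurableEquiv.map_apply]
        congr 3
        ext ω
        simp [X, g, MeasurableEquiv.coe_curry, Function.curry]
    _ ≤ P.real ({ω | (1 + τ) * s ≤ (∑ l, X l) ω} ∪ {ω | (∑ l, X l) ω ≤ (1 - τ) * s}) := by
        refine measureReal_mono fun ω hω => ?_
        by_contra hcon
        simp only [Set.mem_union, Set.mem_ofPred_eq, not_or, not_le] at hcon
        refine hω (abs_le.2 ⟨?_, ?_⟩) <;> linarith [hcon.1, hcon.2]
    _ ≤ _ := by
        rw [two_mul]
        exact (measureReal_union_le _ _).trans (add_le_add hup hlow)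

theorem card_mul_exp_le {d k : ℕ} (hd : 2 ≤ d) (hk : 1 ≤ k) {c ε x : ℝ} (hε : 0 < ε)
    (hc : c ≤ 2 * ((8 * d + 9 : ℝ) ^ k) ^ 2)
    (hx : 12 * (k * Real.log d) + Real.log (1 / ε) ≤ x) : c * (2 * Real.exp (-x)) ≤ ε := by
  have hd' : (2 : ℝ) ≤ d := by exact_mod_cast hd
  have h5 : (8 * d + 9 : ℝ) ≤ (d : ℝ) ^ 5 := by
    have : (2 : ℝ) ^ 4 ≤ (d : ℝ) ^ 4 := by gcongr
    nlinarith
  have h2 : (4 : ℝ) ≤ (d : ℝ) ^ (2 * k) :=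
    calc (4 : ℝ) = 2 ^ 2 := by norm_num
      _ ≤ (d : ℝ) ^ 2 := by gcongr
      _ ≤ (d : ℝ) ^ (2 * k) := pow_le_pow_right₀ (by linarith) (by omega)
  have hexp : Real.exp (12 * (k * Real.log d)) = (d : ℝ) ^ (12 * k) := by
    rw [← Real.rpow_natCast, Real.rpow_def_of_pos (by linarith)]
    congr 1
    push_cast
    ring
  calc c * (2 * Real.exp (-x))
      ≤ 2 * ((8 * d + 9 : ℝ) ^ k) ^ 2 *
          (2 * Real.exp (-(12 * (k * Real.log d) + Real.log (1 / ε)))) := by gcongr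
    _ ≤ 2 * (((d : ℝ) ^ 5) ^ k) ^ 2 *
          (2 * Real.exp (-(12 * (k * Real.log d) + Real.log (1 / ε)))) := by gcongr
    _ = 4 * (d : ℝ) ^ (10 * k) * ((d : ℝ) ^ (12 * k))⁻¹ * ε := by
      rw [neg_add, Real.exp_add, Real.exp_neg, hexp, one_div, Real.log_inv, neg_neg,
        Real.exp_log hε, ← pow_mul, ← pow_mul]
      ring
    _ ≤ (d : ℝ) ^ (2 * k) * (d : ℝ) ^ (10 * k) * ((d : ℝ) ^ (12 * k))⁻¹ * ε := by gcongr
    _ = ε := by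
      rw [← pow_add, show 2 * k + 10 * k = 12 * k by ring, mul_inv_cancel₀ (by positivity),
        one_mul]

theorem tuckerRankLE.eq_zero {d : ℕ} (hd : d ≠ 0) {n r : Fin d → ℕ}
    {u : (∀ j, Fin (n j)) → ℝ} (hu : tuckerRankLE n u r) (hr : ∀ j, r j = 0) : u = 0 := by
  obtain ⟨U, S, -, -, rfl⟩ := hu.exists_modeProd (R := 0) fun j => (hr j).le
  have : IsEmpty (Fin d → Fin 0) := ⟨fun k => (k ⟨0, Nat.pos_of_ne_zero hd⟩).elim0⟩
  funext μ
  simp [modeProd]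

theorem ofReal_one_sub_le_measure {Ω : Type*} [MeasurableSpace Ω] {P : Measure Ω}
    [IsProbabilityMeasure P] {s : Set Ω} {ε : ℝ} (h : P.real sᶜ ≤ ε) :
    ENNReal.ofReal (1 - ε) ≤ P s := by
  rw [← ofReal_measureReal]
  refine ENNReal.ofReal_le_ofReal ?_
  have h1 : P.real (s ∪ sᶜ) ≤ P.real s + P.real sᶜ := measureReal_union_le s sᶜ
  rw [Set.union_compl_self, probReal_univ] at h1
  linarith

theorem gaussian_exists_deviation_le {ι : Type*} [Fintype ι] {m : ℕ} (hm : 1 ≤ m)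
    (Z : Finset (ι → ℝ)) {τ : ℝ} (hτ : 0 ≤ τ) (hτ1 : τ ≤ 1 / 2) :
    (Measure.pi fun _ : Fin m × ι => gaussianReal 0 (m : NNReal)⁻¹).real
      {ω | ∀ z ∈ Z, |∑ l, (∑ i, ω (l, i) * z i) ^ 2 - ∑ i, z i ^ 2| ≤ τ * ∑ i, z i ^ 2}ᶜ ≤
      Z.card * (2 * Real.exp (-(m * τ ^ 2 / 8))) := by
  set B : (ι → ℝ) → Set (Fin m × ι → ℝ) := fun z =>
    {ω | ¬ |∑ l, (∑ i, ω (l, i) * z i) ^ 2 - ∑ i, z i ^ 2| ≤ τ * ∑ i, z i ^ 2} with hB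
  have hunion : {ω : Fin m × ι → ℝ | ∀ z ∈ Z, |∑ l, (∑ i, ω (l, i) * z i) ^ 2 -
      ∑ i, z i ^ 2| ≤ τ * ∑ i, z i ^ 2}ᶜ = ⋃ z ∈ Z, B z := by
    ext ω
    simp [hB]
  rw [hunion, ← nsmul_eq_mul]
  exact (measureReal_biUnion_finset_le Z B).trans
    (Finset.sum_le_card_nsmul _ _ _ fun z _ => gaussian_sum_sq_deviation_le hm z hτ hτ1)

/-- tensor restricted isometry property for Gaussian measurement maps in
the Tucker/HOSVD format.  The entries of the measurement map are i.i.d. `N(0, 1/m)`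
random variables, `n = max n_i` and `r = max r_i`, and the event is that every tensor of
Tucker rank at most `(r_1, …, r_d)` satisfies `(1-δ)‖u‖² ≤ ‖A_ω u‖² ≤ (1+δ)‖u‖²`. -/
theorem trip_gaussian_tucker :
    ∃ C : ℝ, 0 < C ∧
      ∀ (d : ℕ) (n : Fin d → ℕ) (m : ℕ) (r : Fin d → ℕ) (δ ε : ℝ),
        2 ≤ d → (∀ i, 1 ≤ n i) → 1 ≤ m → 0 < δ → δ < 1 → 0 < ε → ε < 1 →
        C * δ⁻¹ ^ 2 *
            max ((((Finset.univ.sup r : ℕ) : ℝ) ^ d +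
                  (d : ℝ) * ((Finset.univ.sup n : ℕ) : ℝ) * ((Finset.univ.sup r : ℕ) : ℝ)) *
                    Real.log d)
                (Real.log (1 / ε)) ≤ (m : ℝ) →
        ENNReal.ofReal (1 - ε) ≤
          (Measure.pi fun _ : Fin m × ((j : Fin d) → Fin (n j)) =>
              gaussianReal 0 (m : NNReal)⁻¹)
            {ω | ∀ u : ((j : Fin d) → Fin (n j)) → ℝ, tuckerRankLE n u r →
              (1 - δ) * (∑ μ, u μ ^ 2) ≤ (∑ ℓ : Fin m, (∑ μ, ω (ℓ, μ) * u μ) ^ 2) ∧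
              (∑ ℓ : Fin m, (∑ μ, ω (ℓ, μ) * u μ) ^ 2) ≤ (1 + δ) * (∑ μ, u μ ^ 2)} := by
  refine ⟨416, by norm_num, fun d n m r δ ε hd _ hm hδ hδ1 hε hε1 hmC => ?_⟩
  set R := Finset.univ.sup r with hR
  set N := Finset.univ.sup n with hN
  have hrR : ∀ j, r j ≤ R := fun j => Finset.le_sup (Finset.mem_univ j)
  rcases Nat.eq_zero_or_pos R with hR0 | hRpos
  · have hprob := ofReal_one_sub_le_measure (ε := ε) (s := Set.univ)
      (P := Measure.pi fun _ : Fin m × ((j : Fin d) → Fin (n j)) => gaussianReal 0 (m : NNReal)⁻¹)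
      (by rw [Set.compl_univ, measureReal_empty]; exact hε.le)
    refine hprob.trans (measure_mono fun ω _ u hu => ?_)
    have hu0 := hu.eq_zero (by omega) fun j => Nat.le_zero.1 ((hrR j).trans_eq hR0)
    simp [hu0]
  obtain ⟨Z, hZcard, hZ⟩ := exists_finset_tuckerRankLE_isometry n R
  set k := R ^ d + d * N * R with hk
  have hk1 : 1 ≤ k := (Nat.one_le_pow _ _ hRpos).trans (Nat.le_add_right _ _)
  have hsum : R ^ d + ∑ j, n j * R ≤ k := by
    refine Nat.add_le_add_left ?_ _
    calc ∑ j, n j * R ≤ ∑ _j : Fin d, N * R :=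
          Finset.sum_le_sum fun j _ => Nat.mul_le_mul_right _ (Finset.le_sup (Finset.mem_univ j))
      _ = d * N * R := by simp [mul_assoc]
  have hx : 12 * (k * Real.log d) + Real.log (1 / ε) ≤ m * (δ / 2) ^ 2 / 8 := by
    have hcast : (k : ℝ) = (R : ℝ) ^ d + d * N * R := by rw [hk]; push_cast; ring
    rw [← hcast] at hmC
    have h1 := le_max_left ((k : ℝ) * Real.log d) (Real.log (1 / ε))
    have h2 := le_max_right ((k : ℝ) * Real.log d) (Real.log (1 / ε))
    have h3 := mul_le_mul_of_nonneg_right hmC (sq_nonneg δ)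
    have h4 : 416 * δ⁻¹ ^ 2 * max ((k : ℝ) * Real.log d) (Real.log (1 / ε)) * δ ^ 2 =
        416 * max ((k : ℝ) * Real.log d) (Real.log (1 / ε)) := by
      field_simp
    rw [h4] at h3
    linarith
  have hcard : (Z.card : ℝ) ≤ 2 * ((8 * d + 9 : ℝ) ^ k) ^ 2 := by
    refine hZcard.trans ?_
    gcongr
    linarith [(Nat.cast_nonneg d : (0 : ℝ) ≤ d)]
  refine (ofReal_one_sub_le_measure ((gaussian_exists_deviation_le hm Z (τ := δ / 2)
    (by linarith) (by linarith)).trans (card_mul_exp_le hd hk1 hε hcard hx))).trans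
    (measure_mono fun ω hω u hu => ?_)
  have h := abs_le.1 (hZ ω (by linarith : 0 ≤ δ / 2) hω r hrR u hu)
  constructor <;> linarith [h.1, h.2]
end

section
/- (Tangent vectors have TT-rank at most 2r.) Let r_0 = r_d = 1 and r_1,…,r_{d−1} be positive integers, and for i = 1,…,d and μ_i ∈ {1,…,n_i} let B_i(μ_i), δB_i(μ_i) ∈ ℝ^{r_{i−1}×r_i} be matrices. Define the tensor δu ∈ ℋ_d by δu(μ_1,…,μ_d) = Σ_{i=1}^{d} B_1(μ_1)⋯B_{i−1}(μ_{i−1}) δB_i(μ_i) B_{i+1}(μ_{i+1})⋯B_d(μ_d). Then for every j = 1,…,d−1 the j-th TT-matricisation of δu has rank at most 2r_j; i.e., δu ∈ M_{≤2r} where 2r = (2r_1,…,2r_{d−1}). -/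
/-- Merge two tuples: entries up to `q` come from the first one, the others from the second. -/
def mergeAt {ι : Type*} [LinearOrder ι] {α : ι → Type*} (q : ι) (k k' : ∀ l, α l) : ∀ l, α l :=
  fun l => if l ≤ q then k l else k' l

/-- A sum over tuples of a product, whose first factor depends only on the entries up to `q` and
whose second factor only on the entries from `q` on, splits along the value of the entry `q`. -/
lemma sum_mul_eq_sum_fiber {ι : Type*} [Fintype ι] [LinearOrder ι] {α : ι → Type*}
    [∀ l, Fintype (α l)] [∀ l, DecidableEq (α l)] (q : ι) (f g : (∀ l, α l) → ℝ)
    (hf : ∀ k k', (∀ l ≤ q, k l = k' l) → f k = f k')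
    (hg : ∀ k k', (∀ l, q ≤ l → k l = k' l) → g k = g k') :
    ∑ k, f k * g k = ∑ s : α q, (∑ k with k q = s, f k) *
      (((Finset.univ.filter fun k : ∀ l, α l => k q = s).card : ℝ)⁻¹ * ∑ k with k q = s, g k) := by
  rw [← Finset.sum_fiberwise (s := Finset.univ) (g := fun k : ∀ l, α l => k q)]
  refine Finset.sum_congr rfl fun s _ => ?_
  set S := Finset.univ.filter fun k : ∀ l, α l => k q = s with hS
  have hmem : ∀ k, k ∈ S ↔ k q = s := by simp [hS]
  have key : (∑ k ∈ S, f k) * ∑ k ∈ S, g k = S.card * ∑ k ∈ S, f k * g k := by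
    rw [Finset.sum_mul_sum, ← Finset.sum_product']
    trans ∑ x ∈ S ×ˢ S, f x.1 * g x.1
    · refine Finset.sum_nbij' (fun x => (mergeAt q x.1 x.2, mergeAt q x.2 x.1))
        (fun x => (mergeAt q x.1 x.2, mergeAt q x.2 x.1)) ?_ ?_ ?_ ?_ ?_
      · rintro ⟨k, k'⟩ h
        simpa [hmem, mergeAt] using h
      · rintro ⟨k, k'⟩ h
        simpa [hmem, mergeAt] using h
      · rintro ⟨k, k'⟩ -
        ext l <;> by_cases hl : l ≤ q <;> simp [mergeAt, hl]
      · rintro ⟨k, k'⟩ -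
        ext l <;> by_cases hl : l ≤ q <;> simp [mergeAt, hl]
      · rintro ⟨k, k'⟩ h
        simp only [Finset.mem_product, hmem] at h
        congr 1
        · exact hf _ _ fun l hl => by simp [mergeAt, hl]
        · refine hg _ _ fun l hl => ?_
          rcases hl.eq_or_lt with rfl | hl
          · simp [mergeAt, h.1, h.2]
          · simp [mergeAt, hl.not_ge]
    · rw [Finset.sum_product]
      simp [Finset.mul_sum]
  rcases S.eq_empty_or_nonempty with h | h
  · simp [h]
  · have hc : (S.card : ℝ) ≠ 0 := by exact_mod_cast h.card_pos.ne'
    rw [mul_left_comm, key, inv_mul_cancel_left₀ hc]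

/-- A matrix that is a sum of products `A i * C i` through a common inner index type, in which
`A i` does not depend on `i` outside `p` and `C i` does not depend on `i` in `p`, has rank at most
twice the size of the inner index type. -/
lemma rank_le_two_mul_of_sum_mul {ι m n r : Type*} [Fintype ι] [Fintype n]
    [Fintype r] (p : ι → Prop) (M : Matrix m n ℝ) (A : ι → Matrix m r ℝ)
    (C : ι → Matrix r n ℝ) (A₀ : Matrix m r ℝ) (C₀ : Matrix r n ℝ)
    (hM : M = ∑ i, A i * C i) (hA : ∀ i, ¬ p i → A i = A₀) (hC : ∀ i, p i → C i = C₀) :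
    M.rank ≤ 2 * Fintype.card r := by
  classical
  have h : M = Matrix.fromCols (∑ i with p i, A i) A₀ *
      Matrix.fromRows C₀ (∑ i with ¬ p i, C i) := by
    rw [Matrix.fromCols_mul_fromRows, hM, Matrix.sum_mul, Matrix.mul_sum,
      ← Finset.sum_filter_add_sum_filter_not _ p]
    congr 1
    · exact Finset.sum_congr rfl fun i hi => by rw [hC i (Finset.mem_filter.1 hi).2]
    · exact Finset.sum_congr rfl fun i hi => by rw [hA i (Finset.mem_filter.1 hi).2]
  rw [h]
  refine (Matrix.rank_mul_le_left _ _).trans ((Matrix.rank_le_card_width _).trans ?_)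
  rw [Fintype.card_sum, two_mul]

/-- tangent vectors of the TT manifold have TT-rank at most `2r`.  Here
`R : Fin (d+1) → ℕ` is the full tuple `(r_0, r_1, …, r_d)` of representation ranks with
`r_0 = r_d = 1` and all `r_i` positive, `B_i(μ_i), δB_i(μ_i) ∈ ℝ^{r_{i-1} × r_i}`, and
`δu(μ) = ∑_{i=1}^d B_1(μ_1) ⋯ B_{i-1}(μ_{i-1}) δB_i(μ_i) B_{i+1}(μ_{i+1}) ⋯ B_d(μ_d)`
(the `1 × 1` matrix products written entrywise as sums over intermediate indices).  Then
the `j`-th TT-matricisation of `δu` has rank at most `2 r_j` for every `j = 1, …, d-1`. -/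
theorem tangent_vector_tt_rank_le_two_r {d : ℕ} (hd : 2 ≤ d) (n : Fin d → ℕ)
    (hn : ∀ i, 1 ≤ n i) (R : Fin (d + 1) → ℕ)
    (hR0 : R 0 = 1) (hRd : R (Fin.last d) = 1) (hRpos : ∀ l, 0 < R l)
    (B δB : (i : Fin d) → Fin (n i) → Matrix (Fin (R i.castSucc)) (Fin (R i.succ)) ℝ)
    (δu : ((j : Fin d) → Fin (n j)) → ℝ)
    (hδu : ∀ μ : (j : Fin d) → Fin (n j),
      δu μ = ∑ i : Fin d, ∑ k : (l : Fin (d + 1)) → Fin (R l),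
        ∏ j : Fin d, (if j = i then δB j (μ j) else B j (μ j)) (k j.castSucc) (k j.succ)) :
    ∀ i : Fin (d - 1),
      (ttMat n δu i.val).rank ≤ 2 * R ⟨i.val + 1, by have := i.isLt; omega⟩ := by
  intro i
  have hi := i.isLt
  set q : Fin (d + 1) := ⟨i.val + 1, by omega⟩ with hq
  have hle : ∀ j : Fin d, j.val ≤ i.val → j.castSucc ≤ q ∧ j.succ ≤ q := fun j hj => by
    simp only [hq, Fin.le_def, Fin.val_castSucc, Fin.val_succ]; omega
  have hge : ∀ j : Fin d, ¬ j.val ≤ i.val → q ≤ j.castSucc ∧ q ≤ j.succ := fun j hj => by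
    simp only [hq, Fin.le_def, Fin.val_castSucc, Fin.val_succ]; omega
  let X (a j : Fin d) (x : Fin (n j)) := if j = a then δB j x else B j x
  let f (Y : (j : Fin d) → Fin (n j) → Matrix (Fin (R j.castSucc)) (Fin (R j.succ)) ℝ)
      (ρ : (j : {j : Fin d // j.val ≤ i.val}) → Fin (n j.val))
      (k : (l : Fin (d + 1)) → Fin (R l)) : ℝ :=
    ∏ j, Y j.val (ρ j) (k j.val.castSucc) (k j.val.succ)
  let g (Y : (j : Fin d) → Fin (n j) → Matrix (Fin (R j.castSucc)) (Fin (R j.succ)) ℝ)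
      (c : (j : {j : Fin d // ¬ j.val ≤ i.val}) → Fin (n j.val))
      (k : (l : Fin (d + 1)) → Fin (R l)) : ℝ :=
    ∏ j, Y j.val (c j) (k j.val.castSucc) (k j.val.succ)
  let F (φ : ((j : {j : Fin d // j.val ≤ i.val}) → Fin (n j.val)) →
      ((l : Fin (d + 1)) → Fin (R l)) → ℝ) :
      Matrix ((j : {j : Fin d // j.val ≤ i.val}) → Fin (n j.val)) (Fin (R q)) ℝ :=
    fun ρ s => ∑ k with k q = s, φ ρ k
  let G (ψ : ((j : {j : Fin d // ¬ j.val ≤ i.val}) → Fin (n j.val)) →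
      ((l : Fin (d + 1)) → Fin (R l)) → ℝ) :
      Matrix (Fin (R q)) ((j : {j : Fin d // ¬ j.val ≤ i.val}) → Fin (n j.val)) ℝ :=
    fun s c => ((Finset.univ.filter fun k : (l : Fin (d + 1)) → Fin (R l) => k q = s).card : ℝ)⁻¹ *
      ∑ k with k q = s, ψ c k
  have hrank := rank_le_two_mul_of_sum_mul (fun a : Fin d => a.val ≤ i.val) (ttMat n δu i.val)
    (fun a => F (f (X a))) (fun a => G (g (X a))) (F (f B)) (G (g B)) ?_ ?_ ?_
  · simpa using hrank
  · ext ρ c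
    simp only [Matrix.sum_apply, ttMat, hδu]
    refine Finset.sum_congr rfl fun a _ => ?_
    refine Eq.trans ?_ (sum_mul_eq_sum_fiber q (f (X a) ρ) (g (X a) c) ?_ ?_)
    · refine Finset.sum_congr rfl fun k _ => ?_
      rw [← Fintype.prod_subtype_mul_prod_subtype (fun j : Fin d => j.val ≤ i.val)]
      congr 1
      · exact Finset.prod_congr rfl fun j _ => by simp only [X, dif_pos j.2]
      · exact Finset.prod_congr rfl fun j _ => by simp only [X, dif_neg j.2]
    · exact fun k k' h => Finset.prod_congr rfl fun j _ => by
        rw [h _ (hle j j.2).1, h _ (hle j j.2).2]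
    · exact fun k k' h => Finset.prod_congr rfl fun j _ => by
        rw [h _ (hge j j.2).1, h _ (hge j j.2).2]
  · intro a ha
    refine congrArg F (funext fun ρ => funext fun k => Finset.prod_congr rfl fun j _ => by
      have hj : j.val ≠ a := fun h => ha (h ▸ j.2)
      simp only [X, if_neg hj])
  · intro a ha
    refine congrArg G (funext fun c => funext fun k => Finset.prod_congr rfl fun j _ => by
      have hj : j.val ≠ a := fun h => j.2 (h ▸ ha)
      simp only [X, if_neg hj])
end

section
/- (Gauging conditions imply pairwise orthogonality of tangential components.) Let r_0 = r_d = 1 and r_1,…,r_{d−1} be positive integers, and for i = 1,…,d, μ_i ∈ {1,…,n_i}, let B_i(μ_i), δB_i(μ_i) ∈ ℝ^{r_{i−1}×r_i}, writing b^i(k_{i−1},μ_i,k_i) and δb^i(k_{i−1},μ_i,k_i) for their entries. Assume the left-orthonormality conditions Σ_{k_{i−1}=1}^{r_{i−1}} Σ_{μ_i=1}^{n_i} b^i(k_{i−1},μ_i,k_i) b^i(k_{i−1},μ_i,k_i') = δ_{k_i k_i'} for all i = 1,…,d−1 and all k_i, k_i', and the gauging conditions Σ_{k_{i−1}=1}^{r_{i−1}}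 Σ_{μ_i=1}^{n_i} b^i(k_{i−1},μ_i,k_i) δb^i(k_{i−1},μ_i,k_i') = 0 for all i = 1,…,d−1 and all k_i, k_i'. For i = 1,…,d define the tensor t^i ∈ ℋ_d by t^i(μ_1,…,μ_d) = B_1(μ_1)⋯B_{i−1}(μ_{i−1}) δB_i(μ_i) B_{i+1}(μ_{i+1})⋯B_d(μ_d). Then the t^i are pairwise orthogonal: ⟨t^i, t^j⟩ = 0 whenever i ≠ j. -/
/-- Contracting a chain of transfer matrices `G` from the left: if the vectors `v` are propagated
by `G`, the full contraction started at `v 0` is the sum of the entries of the last vector. -/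
theorem sum_mul_prod_chain_eq_sum_last {A : Type*} [CommSemiring A] : ∀ {d : ℕ}
    (S : Fin (d + 1) → Type) [∀ l, Fintype (S l)]
    (G : (j : Fin d) → S j.castSucc → S j.succ → A) (v : (l : Fin (d + 1)) → S l → A)
    (_ : ∀ j s', v j.succ s' = ∑ s, v j.castSucc s * G j s s'),
    (∑ s : (l : Fin (d + 1)) → S l, v 0 (s 0) * ∏ j : Fin d, G j (s j.castSucc) (s j.succ)) =
      ∑ x, v (Fin.last d) x
  | 0, S, _, G, v, _ => by
    let : Unique (Fin (0 + 1)) := inferInstanceAs (Unique (Fin 1))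
    simpa using (Equiv.piUnique S).sum_comp fun x => v 0 x
  | d + 1, S, _, G, v, hv => by
    have ih := sum_mul_prod_chain_eq_sum_last (fun l => S l.succ) (fun j => G j.succ)
      (fun l => v l.succ) (fun j => hv j.succ)
    rw [← (Fin.consEquiv S).sum_comp, Fintype.sum_prod_type, Finset.sum_comm]
    refine Eq.trans (Finset.sum_congr rfl fun s _ => ?_) ih
    rw [show v (Fin.succ 0) (s 0) = _ from hv 0 (s 0), Finset.sum_mul]
    refine Finset.sum_congr rfl fun x _ => ?_
    rw [Fin.prod_univ_succ, ← mul_assoc]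
    rfl

/-- The inner product of two tensors in matrix product form is the contraction of a chain of
transfer matrices acting on pairs of indices. -/
theorem sum_mul_matrix_product_eq_sum_prod {A : Type*} [CommSemiring A] {d : ℕ} {n : Fin d → ℕ}
    {R : Fin (d + 1) → ℕ}
    (X Y : (i : Fin d) → Fin (n i) → Matrix (Fin (R i.castSucc)) (Fin (R i.succ)) A) :
    (∑ μ : (l : Fin d) → Fin (n l),
      (∑ k : (l : Fin (d + 1)) → Fin (R l), ∏ j, X j (μ j) (k j.castSucc) (k j.succ)) *
        ∑ k : (l : Fin (d + 1)) → Fin (R l), ∏ j, Y j (μ j) (k j.castSucc) (k j.succ)) =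
      ∑ s : (l : Fin (d + 1)) → Fin (R l) × Fin (R l), ∏ j : Fin d, ∑ m,
        X j m (s j.castSucc).1 (s j.succ).1 * Y j m (s j.castSucc).2 (s j.succ).2 := by
  simp_rw [Finset.prod_univ_sum, Fintype.piFinset_univ, Finset.sum_mul_sum,
    ← Finset.prod_mul_distrib]
  refine Eq.trans (Finset.sum_congr rfl fun μ _ => ?_) Finset.sum_comm
  rw [← Fintype.sum_prod_type']
  exact ((Equiv.arrowProdEquivProdArrow (Fin (d + 1)) (fun l => Fin (R l))
    (fun l => Fin (R l))).sum_comp fun p => ∏ j,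
      X j (μ j) (p.1 j.castSucc) (p.1 j.succ) * Y j (μ j) (p.2 j.castSucc) (p.2 j.succ)).symm

/-- If two matrix product tensors have the same left-orthonormal cores before site `i` and cores
that are mutually orthogonal at site `i`, then the tensors are orthogonal. -/
theorem sum_mul_matrix_product_eq_zero {d : ℕ} {n : Fin d → ℕ} {R : Fin (d + 1) → ℕ}
    (hR0 : R 0 = 1)
    (X Y : (i : Fin d) → Fin (n i) → Matrix (Fin (R i.castSucc)) (Fin (R i.succ)) ℝ) (i : Fin d)
    (horth : ∀ l < i, ∀ k k' : Fin (R l.succ),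
      (∑ k0, ∑ m, X l m k0 k * Y l m k0 k') = if k = k' then 1 else 0)
    (hgauge : ∀ k k' : Fin (R i.succ), (∑ k0, ∑ m, X i m k0 k * Y i m k0 k') = 0) :
    (∑ μ : (l : Fin d) → Fin (n l),
      (∑ k : (l : Fin (d + 1)) → Fin (R l), ∏ j, X j (μ j) (k j.castSucc) (k j.succ)) *
        ∑ k : (l : Fin (d + 1)) → Fin (R l), ∏ j, Y j (μ j) (k j.castSucc) (k j.succ)) = 0 := by
  rw [sum_mul_matrix_product_eq_sum_prod]
  have h0 (x : Fin (R 0) × Fin (R 0)) : x.1 = x.2 := by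
    have := x.1.isLt
    have := x.2.isLt
    ext
    omega
  have key := sum_mul_prod_chain_eq_sum_last (fun l => Fin (R l) × Fin (R l))
    (fun j s s' => ∑ m, X j m s.1 s'.1 * Y j m s.2 s'.2)
    (fun l s => if l ≤ i.castSucc then (if s.1 = s.2 then (1 : ℝ) else 0) else 0) (by
      intro j s'
      rcases lt_trichotomy j i with h | h | h
      · have h1 : j.succ ≤ i.castSucc := Fin.succ_le_castSucc_iff.2 h
        have h2 : j.castSucc ≤ i.castSucc := Fin.castSucc_le_castSucc_iff.2 h.le
        simp [h1, h2, Fintype.sum_prod_type, horth j h]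
      · subst h
        simp [Fintype.sum_prod_type, hgauge, Fin.succ_le_castSucc_iff]
      · have h1 : ¬ j.succ ≤ i.castSucc := fun h' => (Fin.succ_le_castSucc_iff.1 h').not_gt h
        have h2 : ¬ j.castSucc ≤ i.castSucc := fun h' =>
          (Fin.castSucc_le_castSucc_iff.1 h').not_gt h
        simp [h1, h2])
  have hlast : ¬ Fin.last d ≤ i.castSucc := (Fin.castSucc_lt_last i).not_ge
  simpa [h0, hlast] using key

/-- gauging conditions imply pairwise orthogonality of the tangential
components.  Here `R : Fin (d+1) → ℕ` is the full tuple `(r_0, r_1, …, r_d)` of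
representation ranks with `r_0 = r_d = 1` and all `r_i` positive,
`B_i(μ_i), δB_i(μ_i) ∈ ℝ^{r_{i-1} × r_i}` satisfy the left-orthonormality conditions and
the gauging conditions for `i = 1, …, d-1`, and
`t^i(μ) = B_1(μ_1) ⋯ B_{i-1}(μ_{i-1}) δB_i(μ_i) B_{i+1}(μ_{i+1}) ⋯ B_d(μ_d)` (the `1 × 1`
matrix products written entrywise as sums over intermediate indices).  Then `⟨t^i, t^j⟩ = 0`
for `i ≠ j`. -/
theorem gauged_tangential_components_orthogonal {d : ℕ} (hd : 2 ≤ d) (n : Fin d → ℕ)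
    (hn : ∀ i, 1 ≤ n i) (R : Fin (d + 1) → ℕ)
    (hR0 : R 0 = 1) (hRd : R (Fin.last d) = 1) (hRpos : ∀ l, 0 < R l)
    (B δB : (i : Fin d) → Fin (n i) → Matrix (Fin (R i.castSucc)) (Fin (R i.succ)) ℝ)
    (horth : ∀ i : Fin d, i.val < d - 1 → ∀ k k' : Fin (R i.succ),
      (∑ k0 : Fin (R i.castSucc), ∑ μi : Fin (n i), B i μi k0 k * B i μi k0 k') =
        if k = k' then 1 else 0)
    (hgauge : ∀ i : Fin d, i.val < d - 1 → ∀ k k' : Fin (R i.succ),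
      (∑ k0 : Fin (R i.castSucc), ∑ μi : Fin (n i), B i μi k0 k * δB i μi k0 k') = 0)
    (t : Fin d → (((j : Fin d) → Fin (n j)) → ℝ))
    (ht : ∀ (i : Fin d) (μ : (j : Fin d) → Fin (n j)),
      t i μ = ∑ k : (l : Fin (d + 1)) → Fin (R l),
        ∏ j : Fin d, (if j = i then δB j (μ j) else B j (μ j)) (k j.castSucc) (k j.succ)) :
    ∀ i j : Fin d, i ≠ j → (∑ μ : (l : Fin d) → Fin (n l), t i μ * t j μ) = 0 := by
  have main : ∀ i j : Fin d, i < j → (∑ μ : (l : Fin d) → Fin (n l), t i μ * t j μ) = 0 := by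
    intro i j hij
    simp_rw [ht]
    refine sum_mul_matrix_product_eq_zero hR0
      (fun l m => if l = i then δB l m else B l m)
      (fun l m => if l = j then δB l m else B l m) i (fun l hl k k' => ?_) (fun k k' => ?_)
    · simpa [hl.ne, (hl.trans hij).ne] using horth l (by omega) k k'
    · simpa [hij.ne, mul_comm] using hgauge i (by omega) k' k
  intro i j hij
  rcases hij.lt_or_gt with h | h
  · exact main i j h
  · simpa only [mul_comm] using main j i h
end
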